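/- Let (X,d) be a complete separable metric space in which closed balls are compact, let α be a Young function satisfying the Δ₂-condition, and let μ be a probability measure on X. If μ satisfies the modified log-Sobolev inequality plus LSI⁺_α(A) for some A > 0, then μ satisfies the transport-entropy inequality T_α(C⁺) with C⁺ = max( ((p_α−1)A)^{r_α−1} , ((p_α−1)A)^{p_α−1} ). -/

import Mathlib

open MeasureTheory Filter Set Topology
open scoped ENNReal NNReal

noncomputable section

/-- The right derivative of a function `α : ℝ → ℝ`. -/
def rightD (α : ℝ → ℝ) (x : ℝ) : ℝ := derivWithin α (Set.Ioi x) x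

/-- The left derivative of a function `α : ℝ → ℝ`. -/
def leftD (α : ℝ → ℝ) (x : ℝ) : ℝ := derivWithin α (Set.Iio x) x

/-- A Young function: an even, convex, nonnegative function, increasing on `[0,∞)`,
vanishing at `0` and with vanishing right derivative at `0`. -/
structure IsYoung (α : ℝ → ℝ) : Prop where
  nonneg : ∀ x, 0 ≤ α x
  even : ∀ x, α (-x) = α x
  convex : ConvexOn ℝ Set.univ α
  mono : StrictMonoOn α (Set.Ici 0)
  zero : α 0 = 0
  rightD_zero : rightD α 0 = 0

/-- The Δ₂-condition for a Young function. -/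
def DeltaTwo (α : ℝ → ℝ) : Prop := ∃ K > 0, ∀ x : ℝ, α (2 * x) ≤ K * α x

/-- `r_α = inf_{x>0} x α'₋(x)/α(x)`. -/
def rAlpha (α : ℝ → ℝ) : ℝ := sInf {r : ℝ | ∃ x > 0, r = x * leftD α x / α x}

/-- `p_α = sup_{x>0} x α'₊(x)/α(x)`. -/
def pAlpha (α : ℝ → ℝ) : ℝ := sSup {r : ℝ | ∃ x > 0, r = x * rightD α x / α x}

/-- The Fenchel-Legendre transform `α*(y) = sup_x {xy - α(x)}`, with values in `[0,∞]`. -/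
def legendre (α : ℝ → ℝ) (y : ℝ) : ℝ≥0∞ := ⨆ x : ℝ, ENNReal.ofReal (x * y - α x)

/-- `ξ_α(t) = sup_{u>0} α*(t α'₊(u)) / (t α(u))`. -/
def xiAlpha (α : ℝ → ℝ) (t : ℝ) : ℝ≥0∞ :=
  ⨆ u : {u : ℝ // 0 < u}, legendre α (t * rightD α u) / ENNReal.ofReal (t * α u)

/-- A bounded real-valued function. -/
def IsBoundedFun {Y : Type*} (f : Y → ℝ) : Prop := ∃ M, ∀ x, |f x| ≤ M

variable {X : Type*} [MetricSpace X] [MeasurableSpace X]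

/-- The optimal transport cost `T_α(ν,μ)` between two measures, for the cost
function `(x,y) ↦ α(d(x,y))`. -/
def transportCost (α : ℝ → ℝ) (ν μ : Measure X) : ℝ≥0∞ :=
  sInf { c : ℝ≥0∞ | ∃ π : Measure (X × X), π.map Prod.fst = ν ∧ π.map Prod.snd = μ ∧
      c = ∫⁻ z, ENNReal.ofReal (α (dist z.1 z.2)) ∂π }

open Classical in
/-- The relative entropy `H(ν|μ) = ∫ log (dν/dμ) dν` if `ν ≪ μ` (and `+∞` if `ν` is not
absolutely continuous with respect to `μ`, or if the integral diverges). -/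
def relEnt (ν μ : Measure X) : ℝ≥0∞ :=
  if ν ≪ μ ∧ Integrable (fun x => Real.log (ν.rnDeriv μ x).toReal) ν
  then ENNReal.ofReal (∫ x, Real.log (ν.rnDeriv μ x).toReal ∂ν) else ⊤

/-- The transport-entropy inequality `T_α(C)`: for every probability measure `ν`,
`T_α(ν,μ) ≤ C H(ν|μ)`. -/
def TransportEntropy (μ : Measure X) (α : ℝ → ℝ) (C : ℝ) : Prop :=
  ∀ ν : Measure X, IsProbabilityMeasure ν →
    transportCost α ν μ ≤ ENNReal.ofReal C * relEnt ν μ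

/-- The entropy functional `Ent_μ(e^f)`. -/
def entExp (μ : Measure X) (f : X → ℝ) : ℝ :=
  ∫ x, Real.exp (f x) * Real.log (Real.exp (f x)) ∂μ
    - (∫ x, Real.exp (f x) ∂μ) * Real.log (∫ x, Real.exp (f x) ∂μ)

/-- `|∇⁺ f|(x) = limsup_{y → x} [f(y) - f(x)]₊ / d(y,x)` (equal to `0` at isolated
points by the conventions on `limsup` and `sInf` in `ℝ`). -/
def gradPlus (f : X → ℝ) (x : X) : ℝ :=
  limsup (fun y => max (f y - f x) 0 / dist y x) (𝓝[≠] x)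

/-- `|∇⁻ f|(x) = limsup_{y → x} [f(y) - f(x)]₋ / d(y,x)` (equal to `0` at isolated
points by the conventions on `limsup` and `sInf` in `ℝ`). -/
def gradMinus (f : X → ℝ) (x : X) : ℝ :=
  limsup (fun y => max (-(f y - f x)) 0 / dist y x) (𝓝[≠] x)

/-- The modified log-Sobolev inequality plus `LSI⁺_α(A)`. -/
def LSIplus (μ : Measure X) (α : ℝ → ℝ) (A : ℝ) : Prop :=
  ∀ f : X → ℝ, IsBoundedFun f → LocallyLipschitz f →
    ENNReal.ofReal (entExp μ f) ≤
      ENNReal.ofReal A * ∫⁻ x, legendre α (gradPlus f x) * ENNReal.ofReal (Real.exp (f x)) ∂μ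

/-- The modified log-Sobolev inequality minus `LSI⁻_α(A)`. -/
def LSIminus (μ : Measure X) (α : ℝ → ℝ) (A : ℝ) : Prop :=
  ∀ f : X → ℝ, IsBoundedFun f → LocallyLipschitz f →
    ENNReal.ofReal (entExp μ f) ≤
      ENNReal.ofReal A * ∫⁻ x, legendre α (gradMinus f x) * ENNReal.ofReal (Real.exp (f x)) ∂μ

/-- The inf-convolution operator `Q_α^λ f(x) = inf_y {f(y) + λ α(d(x,y))}`. -/
def QInf (α : ℝ → ℝ) (lam : ℝ) (f : X → ℝ) (x : X) : ℝ :=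
  ⨅ y : X, (f y + lam * α (dist x y))

/-- The `(τ)`-log-Sobolev inequality `(τ)-LSI_α(λ, A)`. -/
def TauLSI (μ : Measure X) (α : ℝ → ℝ) (lam A : ℝ) : Prop :=
  ∀ f : X → ℝ, IsBoundedFun f → LocallyLipschitz f →
    entExp μ f ≤ A * ∫ x, (f x - QInf α lam f x) * Real.exp (f x) ∂μ

/-- The `n`-dimensional inf-convolution operator
`Q_{α,n} f(x) = inf_y {f(y) + Σᵢ α(d(xᵢ,yᵢ))}`. -/
def QInfN (α : ℝ → ℝ) {n : ℕ} (f : (Fin n → X) → ℝ) (x : Fin n → X) : ℝ :=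
  ⨅ y : Fin n → X, (f y + ∑ i, α (dist (x i) (y i)))

/-- The `n`-dimensional sup-convolution operator
`P_{α,n} f(x) = sup_y {f(y) - Σᵢ α(d(xᵢ,yᵢ))}`. -/
def PSupN (α : ℝ → ℝ) {n : ℕ} (f : (Fin n → X) → ℝ) (x : Fin n → X) : ℝ :=
  ⨆ y : Fin n → X, (f y - ∑ i, α (dist (x i) (y i)))

end

namespace IsYoung

variable {α : ℝ → ℝ}

lemma pos (hα : IsYoung α) {x : ℝ} (hx : 0 < x) : 0 < α x := by
  simpa [hα.zero] using hα.mono (mem_Ici.2 le_rfl) (mem_Ici.2 hx.le) hx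

lemma le_of_le (hα : IsYoung α) {x y : ℝ} (hx : 0 ≤ x) (hxy : x ≤ y) : α x ≤ α y :=
  hα.mono.monotoneOn (mem_Ici.2 hx) (mem_Ici.2 (hx.trans hxy)) hxy

lemma continuous (hα : IsYoung α) : Continuous α :=
  continuousOn_univ.1 (hα.convex.continuousOn isOpen_univ)

lemma hasRightDeriv (hα : IsYoung α) (x : ℝ) : HasDerivWithinAt α (rightD α x) (Ioi x) x :=
  hα.convex.hasDerivWithinAt_rightDeriv_of_mem_interior (by simp)

lemma leftD_le_rightD (hα : IsYoung α) (x : ℝ) : leftD α x ≤ rightD α x :=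
  hα.convex.leftDeriv_le_rightDeriv_of_mem_interior (by simp)

lemma le_mul_leftD (hα : IsYoung α) {x : ℝ} (hx : 0 < x) : α x ≤ x * leftD α x := by
  have h := hα.convex.slope_le_leftDeriv_of_mem_interior (mem_univ 0) (by simp) hx
  rw [slope_def_field, hα.zero, sub_zero, sub_zero, div_le_iff₀ hx] at h
  rw [mul_comm]
  exact h

lemma mul_rightD_le (hα : IsYoung α) {x : ℝ} (hx : 0 < x) :
    x * rightD α x ≤ α (2 * x) - α x := by
  have h := hα.convex.rightDeriv_le_slope_of_mem_interior (x := x) (y := 2 * x)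
    (by simp) (mem_univ _) (by linarith)
  rw [slope_def_field, le_div_iff₀ (by linarith)] at h
  calc x * rightD α x = rightD α x * (2 * x - x) := by ring
    _ ≤ _ := h

lemma bddAbove_pAlpha (hα : IsYoung α) (hΔ : DeltaTwo α) :
    BddAbove {r : ℝ | ∃ x > 0, r = x * rightD α x / α x} := by
  obtain ⟨K, -, hK⟩ := hΔ
  refine ⟨K - 1, ?_⟩
  rintro _ ⟨x, hx, rfl⟩
  rw [div_le_iff₀ (hα.pos hx)]
  linarith [hα.mul_rightD_le hx, hK x]

lemma mul_rightD_le_pAlpha (hα : IsYoung α) (hΔ : DeltaTwo α) {x : ℝ} (hx : 0 < x) :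
    x * rightD α x ≤ pAlpha α * α x := by
  rw [← div_le_iff₀ (hα.pos hx)]
  exact le_csSup (hα.bddAbove_pAlpha hΔ) ⟨x, hx, rfl⟩

lemma rAlpha_le_mul_leftD (hα : IsYoung α) {x : ℝ} (hx : 0 < x) :
    rAlpha α * α x ≤ x * leftD α x := by
  rw [← le_div_iff₀ (hα.pos hx)]
  refine csInf_le ⟨1, ?_⟩ ⟨x, hx, rfl⟩
  rintro _ ⟨x, hx, rfl⟩
  rw [le_div_iff₀ (hα.pos hx), one_mul]
  exact hα.le_mul_leftD hx

lemma one_le_rAlpha (hα : IsYoung α) : 1 ≤ rAlpha α := by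
  refine le_csInf ⟨_, 1, one_pos, rfl⟩ ?_
  rintro _ ⟨x, hx, rfl⟩
  rw [le_div_iff₀ (hα.pos hx), one_mul]
  exact hα.le_mul_leftD hx

lemma rAlpha_le_pAlpha (hα : IsYoung α) (hΔ : DeltaTwo α) : rAlpha α ≤ pAlpha α := by
  have h1 := hα.rAlpha_le_mul_leftD one_pos
  have h2 := hα.mul_rightD_le_pAlpha hΔ one_pos
  have h3 := hα.leftD_le_rightD 1
  exact le_of_mul_le_mul_right (by linarith) (hα.pos one_pos)

lemma hasRightDeriv_mul_rpow (hα : IsYoung α) (m : ℝ) {x : ℝ} (hx : 0 < x) :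
    HasDerivWithinAt (fun y => α y * y ^ (-m))
      ((x * rightD α x - m * α x) * x ^ (-m - 1)) (Ici x) x := by
  have h := (hα.hasRightDeriv x).Ici_of_Ioi.mul
    ((Real.hasDerivAt_rpow_const (p := -m) (Or.inl hx.ne')).hasDerivWithinAt (s := Ici x))
  convert! h using 1
  have : x ^ (-m) = x ^ (-m - 1) * x := by
    rw [← Real.rpow_add_one hx.ne']; simp
  rw [this]; ring

lemma continuousOn_mul_rpow (hα : IsYoung α) (m : ℝ) {a b : ℝ} (ha : 0 < a) :
    ContinuousOn (fun y => α y * y ^ (-m)) (Icc a b) :=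
  hα.continuous.continuousOn.mul fun _ hx =>
    (Real.continuousAt_rpow_const _ _ (Or.inl (ha.trans_le hx.1).ne')).continuousWithinAt

/-- Growth upper bound: `α(λx) ≤ λ^p α(x)` for `λ ≥ 1`. -/
lemma le_rpow_pAlpha_mul (hα : IsYoung α) (hΔ : DeltaTwo α) {l x : ℝ} (hl : 1 ≤ l)
    (hx : 0 ≤ x) : α (l * x) ≤ l ^ pAlpha α * α x := by
  rcases hx.eq_or_lt with rfl | hx
  · simp [hα.zero]
  have hl0 : 0 < l := by linarith
  have hlx : x ≤ l * x := by nlinarith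
  have h := image_le_of_deriv_right_le_deriv_boundary
    (hα.continuousOn_mul_rpow (pAlpha α) (b := l * x) hx)
    (fun y hy => hα.hasRightDeriv_mul_rpow (pAlpha α) (hx.trans_le hy.1))
    (B := fun _ => α x * x ^ (-pAlpha α)) (B' := fun _ => 0) le_rfl continuousOn_const
    (fun y _ => hasDerivWithinAt_const _ _ _)
    (fun y hy => mul_nonpos_of_nonpos_of_nonneg
      (by linarith [hα.mul_rightD_le_pAlpha hΔ (hx.trans_le hy.1)])
      (Real.rpow_nonneg (hx.trans_le hy.1).le _))
    (right_mem_Icc.2 hlx)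
  simp only [Real.mul_rpow hl0.le hx.le] at h
  have hxp := Real.rpow_pos_of_pos hx (-pAlpha α)
  have hlp := Real.rpow_pos_of_pos hl0 (pAlpha α)
  rw [Real.rpow_neg hl0.le] at h
  field_simp at h
  linarith

/-- Growth lower bound: `α(λx) ≤ λ^r α(x)` for `0 < λ ≤ 1`. -/
lemma le_rpow_rAlpha_mul (hα : IsYoung α) {l x : ℝ} (hl0 : 0 < l) (hl : l ≤ 1)
    (hx : 0 ≤ x) : α (l * x) ≤ l ^ rAlpha α * α x := by
  rcases hx.eq_or_lt with rfl | hx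
  · simp [hα.zero]
  have hlx : l * x ≤ x := by nlinarith
  have hlx0 : 0 < l * x := by positivity
  have h := image_le_of_deriv_right_le_deriv_boundary
    (f := fun _ => α (l * x) * (l * x) ^ (-rAlpha α)) (f' := fun _ => 0)
    (a := l * x) (b := x) continuousOn_const (fun y _ => hasDerivWithinAt_const _ _ _)
    (B := fun y => α y * y ^ (-rAlpha α)) le_rfl
    (hα.continuousOn_mul_rpow (rAlpha α) (b := x) hlx0)
    (fun y hy => hα.hasRightDeriv_mul_rpow (rAlpha α) (hlx0.trans_le hy.1))
    (fun y hy => mul_nonneg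
      (sub_nonneg.2 ((hα.rAlpha_le_mul_leftD (hlx0.trans_le hy.1)).trans
        (mul_le_mul_of_nonneg_left (hα.leftD_le_rightD y) (hlx0.trans_le hy.1).le)))
      (Real.rpow_nonneg (hlx0.trans_le hy.1).le _))
    (right_mem_Icc.2 hlx)
  simp only [Real.mul_rpow hl0.le hx.le] at h
  have hxp := Real.rpow_pos_of_pos hx (-rAlpha α)
  have hlp := Real.rpow_pos_of_pos hl0 (rAlpha α)
  rw [Real.rpow_neg hl0.le] at h
  field_simp at h
  linarith

lemma one_lt_pAlpha (hα : IsYoung α) (hΔ : DeltaTwo α) : 1 < pAlpha α := by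
  by_contra! hp
  have key : ∀ x ∈ Ioc (0 : ℝ) 1, α 1 ≤ slope α 0 x := by
    rintro x ⟨hx, hx1⟩
    have h := hα.le_rpow_pAlpha_mul hΔ (l := x⁻¹) ((one_le_inv₀ hx).2 hx1) hx.le
    rw [inv_mul_cancel₀ hx.ne'] at h
    have h2 : (x⁻¹) ^ pAlpha α ≤ (x⁻¹) ^ (1 : ℝ) :=
      Real.rpow_le_rpow_of_exponent_le ((one_le_inv₀ hx).2 hx1) hp
    rw [Real.rpow_one] at h2
    rw [slope_def_field, hα.zero, sub_zero, sub_zero, div_eq_inv_mul]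
    exact h.trans (mul_le_mul_of_nonneg_right h2 (hα.nonneg x))
  have hlim : Tendsto (slope α 0) (𝓝[>] 0) (𝓝 0) := by
    have := (hasDerivWithinAt_iff_tendsto_slope' (by simp)).1 (hα.hasRightDeriv 0)
    rwa [hα.rightD_zero] at this
  have := ge_of_tendsto hlim
    (Filter.mem_of_superset (Ioc_mem_nhdsGT one_pos) key)
  linarith [hα.pos one_pos]

lemma add_le (hα : IsYoung α) {K : ℝ} (hK0 : 0 < K) (hK : ∀ x : ℝ, α (2 * x) ≤ K * α x)
    {a b : ℝ} (ha : 0 ≤ a) (hb : 0 ≤ b) : α (a + b) ≤ K * (α a + α b) := by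
  have hna := hα.nonneg a
  have hnb := hα.nonneg b
  rcases le_total a b with h | h
  · have := (hα.le_of_le (add_nonneg ha hb) (by linarith : a + b ≤ 2 * b)).trans (hK b)
    nlinarith
  · have := (hα.le_of_le (add_nonneg ha hb) (by linarith : a + b ≤ 2 * a)).trans (hK a)
    nlinarith

end IsYoung

/-- The sup-convolution semigroup `P_t f(x) = sup_y {f(y) - t α(d(x,y)/t)}`. -/
noncomputable def supConv {X : Type*} [MetricSpace X] (α : ℝ → ℝ) (f : X → ℝ) (t : ℝ) (x : X) : ℝ :=
  ⨆ y : X, (f y - t * α (dist x y / t))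

section SupConv

variable {X : Type*} [MetricSpace X] {α : ℝ → ℝ} {f : X → ℝ} {M : ℝ}

lemma le_supConv (hα : IsYoung α) (hf : ∀ x, |f x| ≤ M) {t : ℝ} (ht : 0 < t) (x y : X) :
    f y - t * α (dist x y / t) ≤ supConv α f t x := by
  refine le_ciSup (f := fun y => f y - t * α (dist x y / t)) ⟨M, ?_⟩ y
  rintro _ ⟨z, rfl⟩
  have := mul_nonneg ht.le (hα.nonneg (dist x z / t))
  have := (abs_le.1 (hf z)).2
  simp only
  linarith

lemma self_le_supConv (hα : IsYoung α) (hf : ∀ x, |f x| ≤ M) {t : ℝ} (ht : 0 < t) (x : X) :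
    f x ≤ supConv α f t x := by
  simpa [hα.zero] using le_supConv hα hf ht x x

lemma supConv_le {t c : ℝ} {x : X} (h : ∀ y, f y - t * α (dist x y / t) ≤ c) :
    supConv α f t x ≤ c :=
  haveI : Nonempty X := ⟨x⟩
  ciSup_le h

lemma abs_supConv_le (hα : IsYoung α) (hf : ∀ x, |f x| ≤ M) {t : ℝ} (ht : 0 < t) (x : X) :
    |supConv α f t x| ≤ M := by
  refine abs_le.2 ⟨(abs_le.1 (hf x)).1.trans (self_le_supConv hα hf ht x), supConv_le fun y => ?_⟩
  have := mul_nonneg ht.le (hα.nonneg (dist x y / t))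
  have := (abs_le.1 (hf y)).2
  linarith

lemma supConv_mono_time (hα : IsYoung α) (hf : ∀ x, |f x| ≤ M) {s t : ℝ} (hs : 0 < s)
    (hst : s ≤ t) (x : X) : supConv α f s x ≤ supConv α f t x := by
  have ht : 0 < t := hs.trans_le hst
  refine supConv_le fun y => le_trans ?_ (le_supConv hα hf ht x y)
  have h := hα.convex.2 (mem_univ (dist x y / s)) (mem_univ 0) (by positivity : 0 ≤ s / t)
    (by rw [sub_nonneg, div_le_one ht]; exact hst : 0 ≤ 1 - s / t) (by ring)
  simp only [smul_eq_mul, mul_zero, add_zero, hα.zero] at h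
  have e : s / t * (dist x y / s) = dist x y / t := by field_simp
  rw [e] at h
  have h2 := mul_le_mul_of_nonneg_left h ht.le
  have e2 : t * (s / t * α (dist x y / s)) = s * α (dist x y / s) := by field_simp
  linarith

/-- The semigroup inequality `P_h (P_t f) ≤ P_{t+h} f`. -/
lemma supConv_sub_le_supConv_add (hα : IsYoung α) (hf : ∀ x, |f x| ≤ M) {t h : ℝ} (ht : 0 < t)
    (hh : 0 < h) (x z : X) :
    supConv α f t z - h * α (dist x z / h) ≤ supConv α f (t + h) x := by
  rw [sub_le_iff_le_add]
  refine supConv_le fun y => ?_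
  have hth : 0 < t + h := by positivity
  have h1 := le_supConv hα hf hth x y
  have hc := hα.convex.2 (mem_univ (dist z y / t)) (mem_univ (dist x z / h))
    (by positivity : 0 ≤ t / (t + h)) (by positivity : 0 ≤ h / (t + h)) (by field_simp)
  simp only [smul_eq_mul] at hc
  have e : t / (t + h) * (dist z y / t) + h / (t + h) * (dist x z / h)
      = (dist z y + dist x z) / (t + h) := by field_simp
  rw [e] at hc
  have hm : α (dist x y / (t + h)) ≤ α ((dist z y + dist x z) / (t + h)) :=
    hα.le_of_le (by positivity)
      (div_le_div_of_nonneg_right (by linarith [dist_triangle x z y]) hth.le)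
  have h2 := mul_le_mul_of_nonneg_left (hm.trans hc) hth.le
  have e2 : (t + h) * (t / (t + h) * α (dist z y / t) + h / (t + h) * α (dist x z / h))
      = t * α (dist z y / t) + h * α (dist x z / h) := by field_simp
  linarith

lemma supConv_le_add_mul_rpow (hα : IsYoung α) (hΔ : DeltaTwo α) (hf : ∀ x, |f x| ≤ M) {s t : ℝ}
    (hs : 0 < s) (hst : s ≤ t) (x : X) :
    supConv α f t x ≤ supConv α f s x + 2 * M * ((t / s) ^ (pAlpha α - 1) - 1) := by
  have ht : 0 < t := hs.trans_le hst
  have h1 : 1 ≤ t / s := (one_le_div hs).2 hst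
  have hp := hα.one_lt_pAlpha hΔ
  have hM : 0 ≤ M := (abs_nonneg _).trans (hf x)
  have hq : 1 ≤ (t / s) ^ (pAlpha α - 1) := Real.one_le_rpow h1 (by linarith)
  refine supConv_le fun y => ?_
  have hP := abs_le.1 (abs_supConv_le hα hf hs x)
  rcases le_total (t * α (dist x y / t)) (2 * M) with hy | hy
  · have hg := hα.le_rpow_pAlpha_mul hΔ h1 (x := dist x y / t) (by positivity)
    have e : t / s * (dist x y / t) = dist x y / s := by field_simp
    rw [e] at hg
    have e2 : (t / s) ^ pAlpha α = (t / s) ^ (pAlpha α - 1) * (t / s) := by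
      rw [← Real.rpow_add_one (by positivity)]; simp
    have h2 : s * α (dist x y / s) ≤ (t / s) ^ (pAlpha α - 1) * (t * α (dist x y / t)) := by
      calc s * α (dist x y / s) ≤ s * ((t / s) ^ pAlpha α * α (dist x y / t)) :=
            mul_le_mul_of_nonneg_left hg hs.le
        _ = _ := by rw [e2]; field_simp
    have h3 := le_supConv hα hf hs x y
    nlinarith
  · have := (abs_le.1 (hf y)).2
    nlinarith

/-- A Lipschitz constant in time, on `[a, ∞)`, for the sup-convolution of a function bounded
by `M`. -/
noncomputable def timeLip (α : ℝ → ℝ) (M a : ℝ) : ℝ :=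
  2 * M * ((pAlpha α - 1) * Real.exp (pAlpha α - 1) + 1) / a

lemma timeLip_nonneg (hα : IsYoung α) (hΔ : DeltaTwo α) (hM : 0 ≤ M) {a : ℝ} (ha : 0 < a) :
    0 ≤ timeLip α M a := by
  have hp : 0 < pAlpha α - 1 := by linarith [hα.one_lt_pAlpha hΔ]
  unfold timeLip
  positivity

lemma supConv_le_add_timeLip (hα : IsYoung α) (hΔ : DeltaTwo α) (hf : ∀ x, |f x| ≤ M) {a s t : ℝ}
    (ha : 0 < a) (has : a ≤ s) (hst : s ≤ t) (x : X) :
    supConv α f t x ≤ supConv α f s x + timeLip α M a * (t - s) := by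
  have hs : 0 < s := ha.trans_le has
  have ht : 0 < t := hs.trans_le hst
  have hM : 0 ≤ M := (abs_nonneg _).trans (hf x)
  set q := pAlpha α - 1 with hq
  have hq0 : 0 < q := by linarith [hα.one_lt_pAlpha hΔ]
  set e := (t - s) / s with he
  have he0 : 0 ≤ e := div_nonneg (by linarith) hs.le
  have hea : e ≤ (t - s) / a := div_le_div_of_nonneg_left (by linarith) ha has
  have hexp := Real.exp_pos q
  have hL : 2 * M * (q * Real.exp q + 1) * e ≤ timeLip α M a * (t - s) := by
    calc 2 * M * (q * Real.exp q + 1) * e ≤ 2 * M * (q * Real.exp q + 1) * ((t - s) / a) := by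
          gcongr
      _ = timeLip α M a * (t - s) := by unfold timeLip; ring
  rcases le_total e 1 with h | h
  · have h1 := supConv_le_add_mul_rpow hα hΔ hf hs hst x
    have e1 : t / s = 1 + e := by rw [he]; field_simp; ring
    rw [← hq, e1] at h1
    have h2 : (1 + e) ^ q ≤ 1 + q * e * Real.exp q := by
      calc (1 + e) ^ q ≤ (Real.exp e) ^ q := by
            gcongr; linarith [Real.add_one_le_exp e]
        _ = Real.exp (q * e) := by rw [← Real.exp_mul]; ring_nf
        _ ≤ 1 + q * e * Real.exp (q * e) := by
            have h3 := Real.add_one_le_exp (-(q * e))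
            have h4 : Real.exp (-(q * e)) * Real.exp (q * e) = 1 := by
              rw [← Real.exp_add]; simp
            nlinarith [Real.exp_pos (q * e)]
        _ ≤ 1 + q * e * Real.exp q := by
            gcongr; nlinarith
    have h3 : 2 * M * ((1 + e) ^ q - 1) ≤ 2 * M * (q * e * Real.exp q) :=
      mul_le_mul_of_nonneg_left (by linarith) (by positivity)
    nlinarith [mul_nonneg hM he0]
  · have h1 := abs_le.1 (abs_supConv_le hα hf hs x)
    have h2 := abs_le.1 (abs_supConv_le hα hf ht x)
    have h3 : 0 ≤ M * (q * Real.exp q) * e := by positivity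
    nlinarith

lemma supConv_lipschitz_space (hα : IsYoung α) (hΔ : DeltaTwo α) (hf : ∀ x, |f x| ≤ M) {a t : ℝ}
    (ha : 0 < a) (hat : a ≤ t) :
    LipschitzWith (timeLip α M a + α 1).toNNReal (supConv α f t) := by
  refine LipschitzWith.of_le_add_mul' _ fun z x => ?_
  rcases eq_or_ne z x with rfl | hzx
  · simp
  have hd : 0 < dist z x := dist_pos.2 hzx
  have h1 := supConv_sub_le_supConv_add hα hf (ha.trans_le hat) hd x z
  rw [dist_comm x z, div_self hd.ne'] at h1
  have h2 := supConv_le_add_timeLip hα hΔ hf ha hat (by linarith : t ≤ t + dist z x) x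
  linarith

lemma supConv_lipschitz_time (hα : IsYoung α) (hΔ : DeltaTwo α) (hf : ∀ x, |f x| ≤ M) {a : ℝ}
    (ha : 0 < a) (x : X) :
    LipschitzWith (timeLip α M a).toNNReal (fun t => supConv α f (max t a) x) := by
  have hM : 0 ≤ M := (abs_nonneg _).trans (hf x)
  have hL := timeLip_nonneg hα hΔ hM ha
  refine LipschitzWith.of_le_add_mul' _ fun t s => ?_
  rcases le_total t s with h | h
  · have := supConv_mono_time hα hf (lt_max_of_lt_right ha) (max_le_max_right a h) x
    have := mul_nonneg hL (dist_nonneg (x := t) (y := s))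
    linarith
  · have h1 := supConv_le_add_timeLip hα hΔ hf ha (le_max_right s a) (max_le_max_right a h) x
    have h2 : max t a - max s a ≤ dist t s := by
      rw [Real.dist_eq]
      exact (le_abs_self _).trans (abs_max_sub_max_le_abs t s a)
    nlinarith

lemma supConv_continuous_uncurry (hα : IsYoung α) (hΔ : DeltaTwo α) (hf : ∀ x, |f x| ≤ M) {a : ℝ}
    (ha : 0 < a) :
    Continuous (Function.uncurry fun (x : X) (t : ℝ) => supConv α f (max t a) x) := by
  have h1 (x : X) : Continuous fun t : ℝ => supConv α f (max t a) x :=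
    (supConv_lipschitz_time hα hΔ hf ha x).continuous
  have h2 (t : ℝ) : LipschitzWith (timeLip α M a + α 1).toNNReal (supConv α f (max t a)) :=
    supConv_lipschitz_space hα hΔ hf ha (le_max_right t a)
  generalize (timeLip α M a + α 1).toNNReal = K at h2
  generalize supConv α f = P at h1 h2
  exact continuous_prod_of_continuous_lipschitzWith (fun p : X × ℝ => P (max p.2 a) p.1) K h1 h2

/-- The pointwise Hamilton–Jacobi inequality `α*(|∇⁺(k P_t f)|) ≤ (k/λ) ∂_t P_t f` when
`k α(λu) ≤ λ α(u)`. -/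
lemma legendre_gradPlus_supConv_le (hα : IsYoung α) (hΔ : DeltaTwo α) (hf : ∀ x, |f x| ≤ M)
    {t k l D : ℝ} (ht : 0 < t) (hk : 0 < k) (hl : 0 < l)
    (hkl : ∀ u, 0 ≤ u → k * α (l * u) ≤ l * α u) {x : X}
    (hD : HasDerivAt (fun τ => supConv α f τ x) D t) :
    legendre α (gradPlus (fun y => k * supConv α f t y) x) ≤ ENNReal.ofReal (k / l * D) := by
  set g := fun y => k * supConv α f t y with hg
  have hslope : Tendsto (slope (fun τ => supConv α f τ x) t) (𝓝[>] t) (𝓝 D) :=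
    (hasDerivWithinAt_iff_tendsto_slope' (by simp)).1 hD.hasDerivWithinAt
  have hD0 : 0 ≤ D := by
    refine ge_of_tendsto hslope ?_
    filter_upwards [self_mem_nhdsWithin] with τ hτ
    rw [slope_def_field]
    exact div_nonneg (sub_nonneg.2 (supConv_mono_time hα hf ht (mem_Ioi.1 hτ).le x))
      (sub_nonneg.2 (mem_Ioi.1 hτ).le)
  have hrhs : 0 ≤ k / l * D := by positivity
  have key : ∀ v > 0, gradPlus g x ≤ (k * D + k * α v) / v := by
    intro v hv
    rw [gradPlus]
    rcases (𝓝[≠] x).eq_or_neBot with hbot | hne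
    · rw [hbot]
      simp only [limsup, limsSup, Filter.map_bot, Filter.eventually_bot, ofPred_true,
        Real.sInf_univ]
      have := hα.nonneg v
      positivity
    have hcob : IsCoboundedUnder (· ≤ ·) (𝓝[≠] x)
        (fun y => max (g y - g x) 0 / dist y x) :=
      IsBoundedUnder.isCoboundedUnder_le
        (isBoundedUnder_of_eventually_ge (a := 0)
          (Eventually.of_forall fun y => div_nonneg (le_max_right _ _) dist_nonneg))
    refine le_of_forall_pos_le_add fun ε hε => ?_
    refine limsup_le_of_le hcob ?_
    have htend : Tendsto (fun y => t + dist y x / v) (𝓝[≠] x) (𝓝[>] t) := by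
      refine tendsto_nhdsWithin_iff.2 ⟨?_, ?_⟩
      · have : Continuous fun y : X => t + dist y x / v := by fun_prop
        simpa using (this.tendsto x).mono_left nhdsWithin_le_nhds
      · filter_upwards [self_mem_nhdsWithin] with y hy
        have : 0 < dist y x := dist_pos.2 hy
        have : 0 < dist y x / v := by positivity
        exact mem_Ioi.2 (by linarith)
    have hev : ∀ᶠ y in 𝓝[≠] x,
        slope (fun τ => supConv α f τ x) t (t + dist y x / v) < D + ε * v / k :=
      (hslope.comp htend).eventually_lt_const (by linarith [show 0 < ε * v / k by positivity])
    filter_upwards [hev, self_mem_nhdsWithin] with y hy hyx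
    have hd : 0 < dist y x := dist_pos.2 hyx
    have hh : 0 < dist y x / v := by positivity
    rw [slope_def_field, add_sub_cancel_left, div_lt_iff₀ hh] at hy
    have hs := supConv_sub_le_supConv_add hα hf ht hh x y
    have e : dist x y / (dist y x / v) = v := by rw [dist_comm]; field_simp
    rw [e] at hs
    rw [div_le_iff₀ hd]
    have e2 : ((k * D + k * α v) / v + ε) * dist y x
        = k * ((D + ε * v / k + α v) * (dist y x / v)) := by field_simp; ring
    have := hα.nonneg v
    refine max_le ?_ (by positivity)
    rw [e2, hg]
    simp only
    rw [← mul_sub]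
    refine mul_le_mul_of_nonneg_left ?_ hk.le
    linarith
  refine iSup_le fun u => ENNReal.ofReal_le_ofReal ?_
  rcases le_or_gt u 0 with hu | hu
  · have h0 : 0 ≤ gradPlus g x := by
      rw [gradPlus]
      rcases (𝓝[≠] x).eq_or_neBot with hbot | hne
      · rw [hbot]
        simp [limsup, limsSup]
      · refine le_limsup_of_frequently_le
          (Frequently.of_forall fun y => div_nonneg (le_max_right _ _) dist_nonneg) ?_
        have hlip := supConv_lipschitz_space hα hΔ hf ht le_rfl
        refine ⟨k * (timeLip α M t + α 1).toNNReal, ?_⟩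
        rw [eventually_map]
        filter_upwards [self_mem_nhdsWithin] with y hyx
        have hd : 0 < dist y x := dist_pos.2 hyx
        rw [div_le_iff₀ hd]
        have h1 := hlip.dist_le_mul y x
        rw [Real.dist_eq] at h1
        refine max_le ?_ (by positivity)
        simp only [hg]
        rw [← mul_sub, mul_assoc]
        exact mul_le_mul_of_nonneg_left ((le_abs_self _).trans h1) hk.le
    have := hα.nonneg u
    nlinarith
  · have h1 := key (l * u) (by positivity)
    rw [le_div_iff₀ (by positivity)] at h1
    have h2 := hkl u hu.le
    have h3 : l * (u * gradPlus g x - α u) ≤ k * D := by linarith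
    rw [div_mul_eq_mul_div, le_div_iff₀ hl]
    linarith

end SupConv

section LogMGF

variable {X : Type*} [MeasurableSpace X] {μ : Measure X} [IsProbabilityMeasure μ]

lemma integrable_exp_of_abs_le {g : X → ℝ} {B : ℝ} (hg : Measurable g) (hB : ∀ x, |g x| ≤ B) :
    Integrable (fun x => Real.exp (g x)) μ :=
  .of_bound hg.exp.aestronglyMeasurable (Real.exp B) (Eventually.of_forall fun x => by
    rw [Real.norm_eq_abs, Real.abs_exp]
    exact Real.exp_le_exp.2 ((le_abs_self _).trans (hB x)))

lemma integral_exp_pos_of_abs_le {g : X → ℝ} {B : ℝ} (hg : Measurable g) (hB : ∀ x, |g x| ≤ B) :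
    0 < ∫ x, Real.exp (g x) ∂μ :=
  integral_exp_pos (integrable_exp_of_abs_le hg hB)

lemma log_integral_exp_le_add {g h : X → ℝ} {B c : ℝ} (hg : Measurable g) (hh : Measurable h)
    (hgB : ∀ x, |g x| ≤ B) (hhB : ∀ x, |h x| ≤ B) (hgh : ∀ x, g x ≤ h x + c) :
    Real.log (∫ x, Real.exp (g x) ∂μ) ≤ Real.log (∫ x, Real.exp (h x) ∂μ) + c := by
  have hpos : 0 < ∫ x, Real.exp (h x) ∂μ := integral_exp_pos_of_abs_le hh hhB
  rw [← Real.log_exp c, ← Real.log_mul hpos.ne' (Real.exp_pos _).ne']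
  refine Real.log_le_log (integral_exp_pos_of_abs_le hg hgB) ?_
  rw [← integral_mul_const]
  refine integral_mono (integrable_exp_of_abs_le hg hgB)
    ((integrable_exp_of_abs_le hh hhB).mul_const _) fun x => ?_
  simp only [← Real.exp_add]
  exact Real.exp_le_exp.2 (hgh x)

lemma abs_exp_sub_exp_le {u v B : ℝ} (hu : |u| ≤ B) (hv : |v| ≤ B) :
    |Real.exp u - Real.exp v| ≤ Real.exp B * |u - v| := by
  have key : ∀ u v : ℝ, |u| ≤ B → Real.exp u - Real.exp v ≤ Real.exp B * |u - v| := by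
    intro u v hu
    have h1 : Real.exp u - Real.exp v ≤ Real.exp u * (u - v) := by
      have := Real.add_one_le_exp (v - u)
      have e : Real.exp v = Real.exp u * Real.exp (v - u) := by rw [← Real.exp_add]; ring_nf
      rw [e]
      nlinarith [Real.exp_pos u]
    exact h1.trans ((mul_le_mul_of_nonneg_left (le_abs_self _) (Real.exp_pos u).le).trans
      (mul_le_mul_of_nonneg_right (Real.exp_le_exp.2 ((le_abs_self _).trans hu)) (abs_nonneg _)))
  rw [abs_sub_le_iff]
  exact ⟨key u v hu, by rw [abs_sub_comm]; exact key v u hv⟩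

/-- Differentiation of `t ↦ k(t)⁻¹ log ∫ exp(k(t) P_t) dμ`. -/
lemma exists_hasDerivAt_logMGF {P : ℝ → X → ℝ} {k : ℝ → ℝ} {t k' c B L : ℝ} {Lu : ℝ≥0} {s : Set ℝ}
    {D : X → ℝ} (hs : s ∈ 𝓝 t) (hPm : ∀ τ, Measurable (P τ))
    (hlip : ∀ x, LipschitzOnWith Lu (fun τ => k τ * P τ x) s)
    (hB : ∀ τ ∈ s, ∀ x, |k τ * P τ x| ≤ B) (hk : HasDerivAt k k' t) (hk0 : 0 < k t)
    (hk'0 : k' ≤ 0) (hDm : Measurable D) (hDL : ∀ x, |D x| ≤ L)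
    (hD0 : 0 ≤ ∫ x, D x * Real.exp (k t * P t x) ∂μ)
    (hD : ∀ᵐ x ∂μ, HasDerivAt (fun τ => P τ x) (D x) t)
    (hent : ∫ x, Real.exp (k t * P t x) * Real.log (Real.exp (k t * P t x)) ∂μ
      - (∫ x, Real.exp (k t * P t x) ∂μ) * Real.log (∫ x, Real.exp (k t * P t x) ∂μ)
        ≤ c * ∫ x, D x * Real.exp (k t * P t x) ∂μ)
    (hc : -k' * c ≤ k t ^ 2) :
    ∃ F', 0 ≤ F' ∧
      HasDerivAt (fun τ => (k τ)⁻¹ * Real.log (∫ x, Real.exp (k τ * P τ x) ∂μ)) F' t := by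
  have hts : t ∈ s := mem_of_mem_nhds hs
  have hmt : Measurable fun x => k t * P t x := (hPm t).const_mul _
  have hG := hasDerivAt_integral_of_dominated_loc_of_lip (μ := μ) (𝕜 := ℝ)
    (F := fun τ x => Real.exp (k τ * P τ x)) (x₀ := t) (s := s)
    (F' := fun x => Real.exp (k t * P t x) * (k' * P t x + k t * D x))
    (bound := fun _ => Real.exp B * Lu) hs
    (Eventually.of_forall fun τ => ((hPm τ).const_mul _).exp.aestronglyMeasurable)
    (integrable_exp_of_abs_le hmt (hB t hts))
    (hmt.exp.mul (((hPm t).const_mul _).add (hDm.const_mul _))).aestronglyMeasurable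
    (Eventually.of_forall fun x => by
      refine LipschitzOnWith.of_dist_le_mul fun τ hτ σ hσ => ?_
      rw [Real.dist_eq, Real.coe_nnabs,
        abs_of_nonneg (show 0 ≤ Real.exp B * (Lu : ℝ) by positivity), mul_assoc]
      refine (abs_exp_sub_exp_le (hB τ hτ x) (hB σ hσ x)).trans ?_
      exact mul_le_mul_of_nonneg_left ((hlip x).dist_le_mul τ hτ σ hσ) (Real.exp_pos _).le)
    (integrable_const _)
    (by
      filter_upwards [hD] with x hx
      exact (hk.mul hx).exp)
  obtain ⟨-, hG⟩ := hG
  have hpos : 0 < ∫ x, Real.exp (k t * P t x) ∂μ := integral_exp_pos_of_abs_le hmt (hB t hts)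
  have hF := (hk.inv hk0.ne').mul (hG.log hpos.ne')
  refine ⟨_, ?_, hF⟩
  have hi1 : Integrable (fun x => k t * P t x * Real.exp (k t * P t x)) μ :=
    (integrable_exp_of_abs_le hmt (hB t hts)).bdd_mul (c := B) hmt.aestronglyMeasurable
      (Eventually.of_forall (hB t hts))
  have hi2 : Integrable (fun x => D x * Real.exp (k t * P t x)) μ :=
    (integrable_exp_of_abs_le hmt (hB t hts)).bdd_mul (c := L) hDm.aestronglyMeasurable
      (Eventually.of_forall hDL)
  have e1 : ∫ x, Real.exp (k t * P t x) * (k' * P t x + k t * D x) ∂μ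
      = k' / k t * (∫ x, k t * P t x * Real.exp (k t * P t x) ∂μ)
        + k t * ∫ x, D x * Real.exp (k t * P t x) ∂μ := by
    rw [← integral_const_mul, ← integral_const_mul, ← integral_add (hi1.const_mul _)
      (hi2.const_mul _)]
    refine integral_congr_ae (Eventually.of_forall fun x => ?_)
    simp only
    field_simp
  have e2 : ∫ x, Real.exp (k t * P t x) * Real.log (Real.exp (k t * P t x)) ∂μ
      = ∫ x, k t * P t x * Real.exp (k t * P t x) ∂μ :=
    integral_congr_ae (Eventually.of_forall fun x => by simp only [Real.log_exp]; ring)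
  simp only [e1]
  rw [e2] at hent
  set G := ∫ x, Real.exp (k t * P t x) ∂μ
  set I := ∫ x, k t * P t x * Real.exp (k t * P t x) ∂μ
  set J := ∫ x, D x * Real.exp (k t * P t x) ∂μ
  have hnum : 0 ≤ k' * (I - G * Real.log G) + k t ^ 2 * J := by nlinarith
  have : -k' / k t ^ 2 * Real.log G + (k t)⁻¹ * ((k' / k t * I + k t * J) / G)
      = (k' * (I - G * Real.log G) + k t ^ 2 * J) / (k t ^ 2 * G) := by
    field_simp
    ring
  refine le_of_le_of_eq (div_nonneg hnum (by positivity)) (this.symm.trans ?_)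
  rfl

end LogMGF

section Monotone

variable {X : Type*} [MetricSpace X] [MeasurableSpace X] [BorelSpace X]
  {μ : Measure X} [IsProbabilityMeasure μ] {α : ℝ → ℝ} {f : X → ℝ} {M A : ℝ}

lemma ae_ae_differentiableAt_supConv [SecondCountableTopology X] (hα : IsYoung α)
    (hΔ : DeltaTwo α) (hf : ∀ x, |f x| ≤ M) {a : ℝ} (ha : 0 < a) :
    ∀ᵐ t, ∀ᵐ x ∂μ, DifferentiableAt ℝ (fun τ => supConv α f (max τ a) x) t := by
  refine (Measure.ae_ae_comm ?_).1 (Eventually.of_forall fun x =>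
    (supConv_lipschitz_time hα hΔ hf ha x).ae_differentiableAt_real)
  exact measurableSet_of_differentiableAt_with_param ℝ (supConv_continuous_uncurry hα hΔ hf ha)

lemma measurable_deriv_supConv (hα : IsYoung α) (hΔ : DeltaTwo α) (hf : ∀ x, |f x| ≤ M)
    {a : ℝ} (ha : 0 < a) (t : ℝ) :
    Measurable fun x => deriv (fun τ => supConv α f (max τ a) x) t := by
  have h := supConv_continuous_uncurry hα hΔ hf ha
  generalize supConv α f = P at h ⊢
  exact (measurable_deriv_with_param h).comp measurable_prodMk_right

/-- Entropy bound along the sup-convolution semigroup. -/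
lemma LSIplus.entExp_supConv_le (hLSI : LSIplus μ α A) (hA : 0 < A) (hα : IsYoung α)
    (hΔ : DeltaTwo α) (hf : ∀ x, |f x| ≤ M) {t k l L : ℝ} (ht : 0 < t) (hk : 0 < k) (hl : 0 < l)
    (hkl : ∀ u, 0 ≤ u → k * α (l * u) ≤ l * α u) {D : X → ℝ} (hDm : Measurable D)
    (hDL : ∀ x, |D x| ≤ L) (hD0 : ∀ x, 0 ≤ D x)
    (hD : ∀ᵐ x ∂μ, HasDerivAt (fun τ => supConv α f τ x) (D x) t) :
    entExp μ (fun x => k * supConv α f t x)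
      ≤ A * k / l * ∫ x, D x * Real.exp (k * supConv α f t x) ∂μ := by
  have hlip := supConv_lipschitz_space hα hΔ hf ht le_rfl
  have hB : ∀ x, |k * supConv α f t x| ≤ k * M := fun x => by
    rw [abs_mul, abs_of_pos hk]
    exact mul_le_mul_of_nonneg_left (abs_supConv_le hα hf ht x) hk.le
  have hm : Measurable fun x => k * supConv α f t x := hlip.continuous.measurable.const_mul _
  have hi : Integrable (fun x => D x * Real.exp (k * supConv α f t x)) μ :=
    (integrable_exp_of_abs_le hm hB).bdd_mul (c := L) hDm.aestronglyMeasurable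
      (Eventually.of_forall hDL)
  have hlip' : LocallyLipschitz (fun x => k * supConv α f t x) :=
    ((lipschitzWith_smul k).comp hlip).locallyLipschitz
  have h := hLSI _ ⟨k * M, hB⟩ hlip'
  have hJ : 0 ≤ ∫ x, D x * Real.exp (k * supConv α f t x) ∂μ :=
    integral_nonneg fun x => mul_nonneg (hD0 x) (Real.exp_pos _).le
  refine (ENNReal.ofReal_le_ofReal_iff (by positivity)).1 (h.trans ?_)
  have e : A * k / l * ∫ x, D x * Real.exp (k * supConv α f t x) ∂μ
      = A * ∫ x, k / l * (D x * Real.exp (k * supConv α f t x)) ∂μ := by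
    rw [integral_const_mul]; ring
  rw [e, ENNReal.ofReal_mul hA.le]
  refine mul_le_mul_right ?_ _
  rw [ofReal_integral_eq_lintegral_ofReal (hi.const_mul _) (Eventually.of_forall fun x =>
    mul_nonneg (by positivity) (mul_nonneg (hD0 x) (Real.exp_pos _).le))]
  refine lintegral_mono_ae ?_
  filter_upwards [hD] with x hx
  rw [← mul_assoc, ENNReal.ofReal_mul (mul_nonneg (by positivity) (hD0 x))]
  exact mul_le_mul_left (legendre_gradPlus_supConv_le hα hΔ hf ht hk hl hkl hx) _

/-- Monotonicity of `t ↦ k(t)⁻¹ log ∫ exp(k(t) P_t f) dμ` along an admissible decreasing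
rate `k`. -/
lemma LSIplus.logMGF_supConv_le [SecondCountableTopology X] (hLSI : LSIplus μ α A) (hA : 0 < A)
    (hα : IsYoung α) (hΔ : DeltaTwo α) (hf : ∀ x, |f x| ≤ M) {a b : ℝ} (ha : 0 < a) (hab : a ≤ b)
    {k k' l : ℝ → ℝ} (hk0 : ∀ t ∈ Icc a b, 0 < k t) (hkC : ContDiffOn ℝ 1 k (Icc a b))
    (hk : ∀ t ∈ Ioo a b, HasDerivAt k (k' t) t) (hk' : ∀ t ∈ Ioo a b, k' t ≤ 0)
    (hl : ∀ t ∈ Ioo a b, 0 < l t)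
    (hkl : ∀ t ∈ Ioo a b, ∀ u, 0 ≤ u → k t * α (l t * u) ≤ l t * α u)
    (hkk : ∀ t ∈ Ioo a b, -k' t * A ≤ k t * l t) :
    (k a)⁻¹ * Real.log (∫ x, Real.exp (k a * supConv α f a x) ∂μ)
      ≤ (k b)⁻¹ * Real.log (∫ x, Real.exp (k b * supConv α f b x) ∂μ) := by
  obtain ⟨x₀⟩ : Nonempty X := μ.nonempty_of_neZero
  have hM : 0 ≤ M := (abs_nonneg _).trans (hf x₀)
  set P : ℝ → X → ℝ := fun t x => supConv α f (max t a) x with hP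
  have hmax : ∀ t, 0 < max t a := fun t => lt_max_of_lt_right ha
  have hPM : ∀ t x, |P t x| ≤ M := fun t x => abs_supConv_le hα hf (hmax t) x
  have hPm : ∀ t, Measurable (P t) := fun t =>
    (supConv_lipschitz_space hα hΔ hf ha (le_max_right t a)).continuous.measurable
  have hPl := supConv_lipschitz_time hα hΔ hf (X := X) ha
  obtain ⟨Lk, hLk⟩ := hkC.exists_lipschitzOnWith one_ne_zero (convex_Icc a b) isCompact_Icc
  obtain ⟨C, hC⟩ := isCompact_Icc.exists_bound_of_continuousOn hkC.continuousOn
  have hC0 : 0 ≤ C := (norm_nonneg _).trans (hC a (left_mem_Icc.2 hab))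
  set Lu : ℝ≥0 := Lk * M.toNNReal + C.toNNReal * (timeLip α M a).toNNReal with hLu
  have hlip : ∀ x, LipschitzOnWith Lu (fun τ => k τ * P τ x) (Icc a b) := by
    intro x
    refine LipschitzOnWith.of_dist_le_mul fun τ hτ σ hσ => ?_
    have h1 := hLk.dist_le_mul τ hτ σ hσ
    have h2 := (hPl x).dist_le_mul τ σ
    have h3 := hC σ hσ
    have h4 := hPM τ x
    simp only [Real.dist_eq, Real.norm_eq_abs] at h1 h2 h3 ⊢
    have e : k τ * P τ x - k σ * P σ x = (k τ - k σ) * P τ x + k σ * (P τ x - P σ x) := by ring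
    rw [e, hLu]
    push_cast
    rw [Real.coe_toNNReal _ hM, Real.coe_toNNReal _ hC0]
    refine (abs_add_le _ _).trans ?_
    rw [abs_mul, abs_mul, add_mul]
    refine add_le_add ?_ ?_
    · calc |k τ - k σ| * |P τ x| ≤ (Lk * |τ - σ|) * M := by gcongr
        _ = Lk * M * |τ - σ| := by ring
    · rw [mul_assoc]; gcongr
  have hB : ∀ τ ∈ Icc a b, ∀ x, |k τ * P τ x| ≤ C * M := fun τ hτ x => by
    rw [abs_mul]
    exact mul_le_mul (hC τ hτ) (hPM τ x) (abs_nonneg _) hC0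
  set F : ℝ → ℝ := fun τ => (k τ)⁻¹ * Real.log (∫ x, Real.exp (k τ * P τ x) ∂μ) with hF
  have hUlip : LipschitzOnWith Lu (fun τ => Real.log (∫ x, Real.exp (k τ * P τ x) ∂μ))
      (Icc a b) := by
    refine LipschitzOnWith.of_le_add_mul _ fun τ hτ σ hσ => ?_
    refine log_integral_exp_le_add ((hPm τ).const_mul _) ((hPm σ).const_mul _) (hB τ hτ)
      (hB σ hσ) fun x => ?_
    have := (hlip x).dist_le_mul τ hτ σ hσ
    rw [Real.dist_eq] at this
    linarith [le_abs_self (k τ * P τ x - k σ * P σ x)]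
  have hAC : AbsolutelyContinuousOnInterval F a b := by
    rw [← uIcc_of_le hab] at hUlip hkC
    refine (ContDiffOn.absolutelyContinuousOnInterval (hkC.inv fun t ht => ?_)).fun_mul
      hUlip.absolutelyContinuousOnInterval
    rw [uIcc_of_le hab] at ht
    exact (hk0 t ht).ne'
  have hder : 0 ≤ ∫ t in a..b, deriv F t := by
    refine intervalIntegral.integral_nonneg_of_ae_restrict hab ?_
    rw [← restrict_Ioo_eq_restrict_Icc]
    refine (ae_restrict_iff' measurableSet_Ioo).2 ?_
    filter_upwards [ae_ae_differentiableAt_supConv (μ := μ) hα hΔ hf ha] with t ht htab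
    have hat : max t a = t := max_eq_left htab.1.le
    have ht0 : 0 < t := ha.trans htab.1
    set D : X → ℝ := fun x => deriv (fun τ => P τ x) t with hDdef
    have hDm : Measurable D := measurable_deriv_supConv hα hΔ hf ha t
    have hDL : ∀ x, |D x| ≤ (timeLip α M a).toNNReal := fun x =>
      norm_deriv_le_of_lipschitz (hPl x)
    have hD0 : ∀ x, 0 ≤ D x := fun x => Monotone.deriv_nonneg (fun τ σ h =>
      supConv_mono_time hα hf (hmax τ) (max_le_max_right a h) x)
    have hDP : ∀ᵐ x ∂μ, HasDerivAt (fun τ => P τ x) (D x) t := by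
      filter_upwards [ht] with x hx
      exact hx.hasDerivAt
    have hDs : ∀ᵐ x ∂μ, HasDerivAt (fun τ => supConv α f τ x) (D x) t := by
      filter_upwards [hDP] with x hx
      refine hx.congr_of_eventuallyEq ?_
      filter_upwards [Ioi_mem_nhds htab.1] with τ hτ
      simp only [hP, max_eq_left (mem_Ioi.1 hτ).le]
    have hkt := hk0 t (Ioo_subset_Icc_self htab)
    have hlt := hl t htab
    have hent := hLSI.entExp_supConv_le hA hα hΔ hf ht0 hkt hlt (hkl t htab) hDm hDL hD0 hDs
    have hPt : supConv α f t = P t := by simp only [hP, hat]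
    simp only [entExp, hPt] at hent
    obtain ⟨F', hF'0, hF'⟩ := exists_hasDerivAt_logMGF (μ := μ)
      (Icc_mem_nhds htab.1 htab.2) hPm hlip hB (hk t htab)
      hkt (hk' t htab) hDm hDL
      (integral_nonneg fun x => mul_nonneg (hD0 x) (Real.exp_pos _).le) hDP hent
      (by
        have := hkk t htab
        have e : -k' t * (A * k t / l t) = (-k' t * A) / l t * k t := by ring
        rw [e, sq]
        refine mul_le_mul_of_nonneg_right ?_ hkt.le
        rwa [div_le_iff₀ hlt])
    rw [hF'.deriv]
    exact hF'0
  rw [hAC.integral_deriv_eq_sub, sub_nonneg] at hder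
  simpa only [hF, hP, max_self, max_eq_left hab] using hder

end Monotone

section Entropy

variable {X : Type*} [MeasurableSpace X] {μ ν : Measure X} [IsProbabilityMeasure μ]
  [IsProbabilityMeasure ν]

/-- The easy half of the variational formula for the relative entropy. -/
lemma integral_le_log_integral_exp_add (hνμ : ν ≪ μ) (hH : Integrable (llr ν μ) ν) {g : X → ℝ}
    {B : ℝ} (hg : Measurable g) (hB : ∀ x, |g x| ≤ B) :
    ∫ x, g x ∂ν ≤ Real.log (∫ x, Real.exp (g x) ∂μ) + ∫ x, llr ν μ x ∂ν := by
  have hi : Integrable (fun x => Real.exp (g x)) μ := integrable_exp_of_abs_le hg hB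
  have hgν : Integrable g ν := .of_bound hg.aestronglyMeasurable B (Eventually.of_forall hB)
  have : IsProbabilityMeasure (μ.tilted g) := isProbabilityMeasure_tilted hi
  have h1 := integral_llr_tilted_right hνμ hgν hi hH
  have h2 := InformationTheory.integral_llr_add_sub_measure_univ_nonneg
    (hνμ.trans (absolutelyContinuous_tilted hi)) (integrable_llr_tilted_right hνμ hgν hH hi)
  simp only [probReal_univ, add_sub_cancel_right] at h2
  linarith

lemma inv_mul_log_integral_exp_le {g : X → ℝ} {M k : ℝ} (hk : 0 < k) (hkM : k * M ≤ 1)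
    (hg : Measurable g) (hM : ∀ x, |g x| ≤ M) :
    k⁻¹ * Real.log (∫ x, Real.exp (k * g x) ∂μ) ≤ ∫ x, g x ∂μ + k * M ^ 2 := by
  have hB : ∀ x, |k * g x| ≤ k * M := fun x => by
    rw [abs_mul, abs_of_pos hk]
    exact mul_le_mul_of_nonneg_left (hM x) hk.le
  have hgi : Integrable g μ := .of_bound hg.aestronglyMeasurable M (Eventually.of_forall hM)
  have hle : ∫ x, Real.exp (k * g x) ∂μ ≤ ∫ x, (1 + k * g x + (k * M) ^ 2) ∂μ := by
    refine integral_mono (integrable_exp_of_abs_le (hg.const_mul _) hB)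
      (((integrable_const _).add (hgi.const_mul _)).add (integrable_const _)) fun x => ?_
    have h1 := Real.abs_exp_sub_one_sub_id_le ((hB x).trans hkM)
    have h2 : (k * g x) ^ 2 ≤ (k * M) ^ 2 := sq_le_sq' (abs_le.1 (hB x)).1 (abs_le.1 (hB x)).2
    have h3 := (abs_le.1 h1).2
    simp only
    linarith
  have hi : Integrable (fun x => 1 + k * g x) μ := (integrable_const _).add (hgi.const_mul _)
  rw [integral_add hi (integrable_const _),
    integral_add (integrable_const _) (hgi.const_mul _), integral_const_mul] at hle
  simp only [integral_const, probReal_univ, smul_eq_mul, one_mul] at hle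
  have hlog := Real.log_le_sub_one_of_pos
    (integral_exp_pos_of_abs_le (μ := μ) (hg.const_mul k) hB)
  rw [inv_mul_le_iff₀ hk]
  nlinarith

end Entropy

section Functional

variable {X : Type*} [MetricSpace X] [SecondCountableTopology X] [MeasurableSpace X] [BorelSpace X]
  {μ ν : Measure X} [IsProbabilityMeasure μ] {α : ℝ → ℝ} {f : X → ℝ} {M A : ℝ}

lemma LSIplus.logMGF_supConv_rpow_le (hLSI : LSIplus μ α A) (hA : 0 < A) (hα : IsYoung α)
    (hΔ : DeltaTwo α) (hf : ∀ x, |f x| ≤ M) {a b c m : ℝ} (ha : 0 < a) (hab : a ≤ b) (hb : b < 1)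
    (hc : c = (pAlpha α - 1) * A) (hm : 1 ≤ m) (hmp : m ≤ pAlpha α)
    (hαm : ∀ t ∈ Ioo a b, ∀ u, 0 ≤ u →
      α (((1 - t) / c)⁻¹ * u) ≤ ((1 - t) / c)⁻¹ ^ m * α u) :
    (((1 - a) / c) ^ (m - 1))⁻¹
        * Real.log (∫ x, Real.exp (((1 - a) / c) ^ (m - 1) * supConv α f a x) ∂μ)
      ≤ (((1 - b) / c) ^ (m - 1))⁻¹
        * Real.log (∫ x, Real.exp (((1 - b) / c) ^ (m - 1) * supConv α f b x) ∂μ) := by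
  have hp := hα.one_lt_pAlpha hΔ
  have hc0 : 0 < c := by rw [hc]; exact mul_pos (by linarith) hA
  have hκ : ∀ t ≤ b, 0 < (1 - t) / c := fun t ht => div_pos (by linarith) hc0
  refine hLSI.logMGF_supConv_le hA hα hΔ hf ha hab (k := fun t => ((1 - t) / c) ^ (m - 1))
    (k' := fun t => (-1 / c) * (m - 1) * ((1 - t) / c) ^ (m - 1 - 1))
    (l := fun t => ((1 - t) / c)⁻¹) (fun t ht => Real.rpow_pos_of_pos (hκ t ht.2) _) ?_ ?_ ?_ ?_ ?_
    ?_
  · refine ContDiffOn.rpow_const_of_ne ?_ fun t ht => (hκ t ht.2).ne'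
    fun_prop
  · intro t ht
    have h : HasDerivAt (fun t : ℝ => (1 - t) / c) (-1 / c) t :=
      ((hasDerivAt_id t).const_sub 1).div_const c
    exact h.rpow_const (Or.inl (hκ t ht.2.le).ne')
  · intro t ht
    have := Real.rpow_pos_of_pos (hκ t ht.2.le) (m - 1 - 1)
    have h1 : 0 ≤ m - 1 := by linarith
    have : 0 ≤ 1 / c * (m - 1) * ((1 - t) / c) ^ (m - 1 - 1) := by positivity
    simp only [neg_div]
    linarith
  · exact fun t ht => inv_pos.2 (hκ t ht.2.le)
  · intro t ht u hu
    have h := hκ t ht.2.le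
    refine (mul_le_mul_of_nonneg_left (hαm t ht u hu) (Real.rpow_nonneg h.le _)).trans_eq ?_
    rw [← mul_assoc, Real.inv_rpow h.le, Real.rpow_sub_one h.ne']
    have := Real.rpow_pos_of_pos h m
    field_simp
  · intro t ht
    have h := hκ t ht.2.le
    have hpos := Real.rpow_pos_of_pos h (m - 1)
    rw [Real.rpow_sub_one h.ne' (m - 1), div_eq_mul_inv _ ((1 - t) / c)]
    have h1 : (m - 1) * A / c ≤ 1 := by
      rw [div_le_one hc0, hc]
      exact mul_le_mul_of_nonneg_right (by linarith) hA.le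
    have h2 : 0 ≤ ((1 - t) / c) ^ (m - 1) * ((1 - t) / c)⁻¹ := by positivity
    calc _ = (m - 1) * A / c * (((1 - t) / c) ^ (m - 1) * ((1 - t) / c)⁻¹) := by ring
      _ ≤ 1 * (((1 - t) / c) ^ (m - 1) * ((1 - t) / c)⁻¹) := mul_le_mul_of_nonneg_right h1 h2
      _ = _ := one_mul _

lemma LSIplus.logMGF_supConv_le_integral_of_le_one (hLSI : LSIplus μ α A) (hA : 0 < A)
    (hα : IsYoung α) (hΔ : DeltaTwo α) (hf : ∀ x, |f x| ≤ M) {s c : ℝ} (hs : 0 < s) (hs1 : s < 1)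
    (hc : c = (pAlpha α - 1) * A) (hκs : (1 - s) / c ≤ 1) :
    (((1 - s) / c) ^ (pAlpha α - 1))⁻¹
        * Real.log (∫ x, Real.exp (((1 - s) / c) ^ (pAlpha α - 1) * supConv α f s x) ∂μ)
      ≤ ∫ x, supConv α f 1 x ∂μ := by
  have hp := hα.one_lt_pAlpha hΔ
  have hc0 : 0 < c := by rw [hc]; exact mul_pos (by linarith) hA
  have hmeas : ∀ t, 0 < t → Measurable (supConv α f t) := fun t ht =>
    (supConv_lipschitz_space hα hΔ hf ht le_rfl).continuous.measurable
  have hlim : Tendsto (fun t : ℝ => ((1 - t) / c) ^ (pAlpha α - 1)) (𝓝[<] 1) (𝓝 0) := by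
    have h : Tendsto (fun t : ℝ => ((1 - t) / c) ^ (pAlpha α - 1)) (𝓝 1)
        (𝓝 (((1 - 1) / c) ^ (pAlpha α - 1))) :=
      ContinuousAt.rpow_const (by fun_prop) (Or.inr (by linarith))
    rw [sub_self, zero_div, Real.zero_rpow (by linarith)] at h
    exact h.mono_left nhdsWithin_le_nhds
  have hlim' : Tendsto (fun t : ℝ => ∫ x, supConv α f 1 x ∂μ
      + ((1 - t) / c) ^ (pAlpha α - 1) * M ^ 2) (𝓝[<] 1)
      (𝓝 (∫ x, supConv α f 1 x ∂μ + 0 * M ^ 2)) := (hlim.mul_const _).const_add _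
  rw [zero_mul, add_zero] at hlim'
  refine ge_of_tendsto hlim' ?_
  have hsmall : ∀ᶠ t in 𝓝[<] (1 : ℝ), ((1 - t) / c) ^ (pAlpha α - 1) * M < 1 := by
    have := hlim.mul_const M
    rw [zero_mul] at this
    exact this.eventually_lt_const one_pos
  filter_upwards [hsmall, Ioo_mem_nhdsLT hs1] with t ht hst
  have ht0 : 0 < t := hs.trans hst.1
  refine (hLSI.logMGF_supConv_rpow_le hA hα hΔ hf hs hst.1.le hst.2 hc hp.le le_rfl
    fun τ hτ u hu => hα.le_rpow_pAlpha_mul hΔ ?_ hu).trans ?_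
  · refine (one_le_inv₀ (div_pos (by linarith [hτ.2, hst.2]) hc0)).2 (le_trans ?_ hκs)
    gcongr
    exact hτ.1.le
  refine (inv_mul_log_integral_exp_le (Real.rpow_pos_of_pos (div_pos (by linarith [hst.2]) hc0) _)
    ht.le (hmeas t ht0) (abs_supConv_le hα hf ht0)).trans ?_
  refine add_le_add_left (integral_mono ?_ ?_ fun x => supConv_mono_time hα hf ht0 hst.2.le x) _
  · exact .of_bound (hmeas t ht0).aestronglyMeasurable M
      (Eventually.of_forall (abs_supConv_le hα hf ht0))
  · exact .of_bound (hmeas 1 one_pos).aestronglyMeasurable M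
      (Eventually.of_forall (abs_supConv_le hα hf one_pos))

lemma LSIplus.logMGF_supConv_le_integral (hLSI : LSIplus μ α A) (hA : 0 < A)
    (hα : IsYoung α) (hΔ : DeltaTwo α) (hf : ∀ x, |f x| ≤ M) {s c k : ℝ} (hs : 0 < s) (hs1 : s < 1)
    (hc : c = (pAlpha α - 1) * A)
    (hk : k = min (((1 - s) / c) ^ (rAlpha α - 1)) (((1 - s) / c) ^ (pAlpha α - 1))) :
    k⁻¹ * Real.log (∫ x, Real.exp (k * supConv α f s x) ∂μ) ≤ ∫ x, supConv α f 1 x ∂μ := by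
  have hp := hα.one_lt_pAlpha hΔ
  have hrp := hα.rAlpha_le_pAlpha hΔ
  have hc0 : 0 < c := by rw [hc]; exact mul_pos (by linarith) hA
  have hκ0 : 0 < (1 - s) / c := div_pos (by linarith) hc0
  rcases le_or_gt ((1 - s) / c) 1 with h | h
  · rw [min_eq_right (Real.rpow_le_rpow_of_exponent_ge hκ0 h (by linarith))] at hk
    rw [hk]
    exact hLSI.logMGF_supConv_le_integral_of_le_one hA hα hΔ hf hs hs1 hc h
  · rw [min_eq_left (Real.rpow_le_rpow_of_exponent_le h.le (by linarith))] at hk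
    rw [hk]
    have hst : s < 1 - c := by
      have := (one_lt_div hc0).1 h
      linarith
    have hone : (1 - (1 - c)) / c = 1 := by rw [sub_sub_cancel, div_self hc0.ne']
    have h1 := hLSI.logMGF_supConv_le_integral_of_le_one hA hα hΔ hf (hs.trans hst)
      (by linarith) hc hone.le
    have h2 := hLSI.logMGF_supConv_rpow_le hA hα hΔ hf hs hst.le (by linarith) hc
      hα.one_le_rAlpha hrp fun τ hτ u hu => hα.le_rpow_rAlpha_mul ?_ ?_ hu
    · rw [hone, Real.one_rpow] at h1 h2
      exact h2.trans h1
    · exact inv_pos.2 (div_pos (by linarith [hτ.2]) hc0)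
    · exact inv_le_one_of_one_le₀ ((one_le_div hc0).2 (by linarith [hτ.2]))

/-- The dual form of the transport-entropy inequality. -/
lemma LSIplus.integral_le_integral_supConv_add (hLSI : LSIplus μ α A) (hA : 0 < A)
    (hα : IsYoung α) (hΔ : DeltaTwo α) (hf : ∀ x, |f x| ≤ M) (hfm : Measurable f)
    [IsProbabilityMeasure ν] (hνμ : ν ≪ μ) (hH : Integrable (llr ν μ) ν) :
    ∫ x, f x ∂ν ≤ ∫ x, supConv α f 1 x ∂μ
      + max (((pAlpha α - 1) * A) ^ (rAlpha α - 1)) (((pAlpha α - 1) * A) ^ (pAlpha α - 1))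
        * ∫ x, llr ν μ x ∂ν := by
  have hp := hα.one_lt_pAlpha hΔ
  obtain ⟨c, hc⟩ : ∃ c, c = (pAlpha α - 1) * A := ⟨_, rfl⟩
  have hc0 : 0 < c := by rw [hc]; exact mul_pos (by linarith) hA
  rw [← hc]
  set k : ℝ → ℝ := fun s =>
    min (((1 - s) / c) ^ (rAlpha α - 1)) (((1 - s) / c) ^ (pAlpha α - 1)) with hk
  have hk0 : (k 0)⁻¹ = max (c ^ (rAlpha α - 1)) (c ^ (pAlpha α - 1)) := by
    have h1 := Real.rpow_pos_of_pos hc0 (rAlpha α - 1)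
    have h2 := Real.rpow_pos_of_pos hc0 (pAlpha α - 1)
    simp only [hk, sub_zero, one_div, Real.inv_rpow hc0.le]
    rcases le_total (c ^ (rAlpha α - 1)) (c ^ (pAlpha α - 1)) with h | h
    · rw [max_eq_right h, min_eq_right ((inv_le_inv₀ h2 h1).2 h), inv_inv]
    · rw [max_eq_left h, min_eq_left ((inv_le_inv₀ h1 h2).2 h), inv_inv]
  have hk0' : k 0 ≠ 0 := by
    have h1 := Real.rpow_pos_of_pos hc0 (rAlpha α - 1)
    intro h
    rw [h, inv_zero] at hk0
    exact (lt_max_of_lt_left h1).ne hk0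
  have hkc : ContinuousAt k 0 := by
    have h : (1 - (0 : ℝ)) / c ≠ 0 := by simp [hc0.ne']
    refine Filter.Tendsto.min ?_ ?_ <;>
    exact ContinuousAt.rpow_const (by fun_prop) (Or.inl h)
  rw [← hk0]
  have hlim : Tendsto (fun s => ∫ x, supConv α f 1 x ∂μ + (k s)⁻¹ * ∫ x, llr ν μ x ∂ν) (𝓝[>] 0)
      (𝓝 (∫ x, supConv α f 1 x ∂μ + (k 0)⁻¹ * ∫ x, llr ν μ x ∂ν)) :=
    (((hkc.inv₀ hk0').mul continuousAt_const).const_add _).tendsto.mono_left nhdsWithin_le_nhds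
  refine ge_of_tendsto hlim ?_
  filter_upwards [Ioo_mem_nhdsGT (zero_lt_one' ℝ)] with s hs
  have hks : 0 < k s := lt_min (Real.rpow_pos_of_pos (div_pos (by linarith [hs.2]) hc0) _)
    (Real.rpow_pos_of_pos (div_pos (by linarith [hs.2]) hc0) _)
  have h1 := hLSI.logMGF_supConv_le_integral hA hα hΔ hf hs.1 hs.2 hc (k := k s) rfl
  have hsm : Measurable (supConv α f s) :=
    (supConv_lipschitz_space hα hΔ hf hs.1 le_rfl).continuous.measurable
  have hsM := abs_supConv_le hα hf hs.1
  have h2 := integral_le_log_integral_exp_add hνμ hH (g := fun x => k s * supConv α f s x)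
    (B := k s * M) (hsm.const_mul _) fun x => by
      rw [abs_mul, abs_of_pos hks]
      exact mul_le_mul_of_nonneg_left (hsM x) hks.le
  rw [integral_const_mul] at h2
  have h3 : ∫ x, f x ∂ν ≤ ∫ x, supConv α f s x ∂ν :=
    integral_mono (.of_bound hfm.aestronglyMeasurable M (Eventually.of_forall hf))
      (.of_bound hsm.aestronglyMeasurable M (Eventually.of_forall hsM))
      fun x => self_le_supConv hα hf hs.1 x
  calc ∫ x, f x ∂ν ≤ ∫ x, supConv α f s x ∂ν := h3
    _ = (k s)⁻¹ * (k s * ∫ x, supConv α f s x ∂ν) := (inv_mul_cancel_left₀ hks.ne' _).symm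
    _ ≤ (k s)⁻¹ * (Real.log (∫ x, Real.exp (k s * supConv α f s x) ∂μ) + ∫ x, llr ν μ x ∂ν) :=
      mul_le_mul_of_nonneg_left h2 (inv_pos.2 hks).le
    _ ≤ _ := by rw [mul_add]; linarith

end Functional

lemma integrable_of_integral_min_le {X : Type*} [MeasurableSpace X] {μ : Measure X}
    [IsFiniteMeasure μ] {g : X → ℝ} {c : ℝ} (hg : Measurable g) (hg0 : ∀ x, 0 ≤ g x)
    (h : ∀ n : ℕ, ∫ x, min (g x) n ∂μ ≤ c) : Integrable g μ := by
  refine ⟨hg.aestronglyMeasurable, ?_⟩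
  rw [hasFiniteIntegral_iff_ofReal (Eventually.of_forall hg0)]
  have hlim := lintegral_tendsto_of_tendsto_of_monotone (μ := μ)
    (f := fun (n : ℕ) x => ENNReal.ofReal (min (g x) n)) (F := fun x => ENNReal.ofReal (g x))
    (fun n => (hg.min measurable_const).ennreal_ofReal.aemeasurable)
    (Eventually.of_forall fun x m n hmn =>
      ENNReal.ofReal_le_ofReal (min_le_min_left _ (Nat.cast_le.2 hmn)))
    (Eventually.of_forall fun x => by
      refine tendsto_const_nhds.congr' ?_
      filter_upwards [tendsto_natCast_atTop_atTop.eventually_ge_atTop (g x)] with n hn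
      rw [min_eq_left hn])
  refine (le_of_tendsto' hlim fun n => ?_).trans_lt (ENNReal.ofReal_lt_top (r := c))
  have h0 : ∀ x, 0 ≤ min (g x) n := fun x => le_min (hg0 x) (Nat.cast_nonneg n)
  rw [← ofReal_integral_eq_lintegral_ofReal _ (Eventually.of_forall h0)]
  · exact ENNReal.ofReal_le_ofReal (h n)
  · refine .of_bound (hg.min measurable_const).aestronglyMeasurable n
      (Eventually.of_forall fun x => ?_)
    rw [Real.norm_eq_abs, abs_of_nonneg (h0 x)]
    exact min_le_right _ _

lemma exists_measure_closedBall_pos {X : Type*} [PseudoMetricSpace X] [MeasurableSpace X]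
    (μ : Measure X) [NeZero μ] (o : X) : ∃ R : ℝ, 0 ≤ R ∧ 0 < μ (Metric.closedBall o R) := by
  by_contra! h
  have h0 : μ (⋃ n : ℕ, Metric.closedBall o n) = 0 :=
    measure_iUnion_null fun n => le_antisymm (h n (Nat.cast_nonneg n)) bot_le
  rw [Metric.iUnion_closedBall_nat] at h0
  exact NeZero.ne μ (Measure.measure_univ_eq_zero.1 h0)

section Moments

variable {X : Type*} [MetricSpace X] [SecondCountableTopology X] [MeasurableSpace X] [BorelSpace X]
  {μ ν : Measure X} [IsProbabilityMeasure μ] {α : ℝ → ℝ} {A : ℝ}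

lemma LSIplus.integrable_comp_dist (hLSI : LSIplus μ α A) (hA : 0 < A)
    (hα : IsYoung α) (hΔ : DeltaTwo α) (o : X) : Integrable (fun x => α (dist x o)) μ := by
  obtain ⟨R, hR0, hR⟩ := exists_measure_closedBall_pos μ o
  obtain ⟨c, hc⟩ : ∃ c, c = (pAlpha α - 1) * A := ⟨_, rfl⟩
  have hc0 : 0 < c := by rw [hc]; exact mul_pos (by linarith [hα.one_lt_pAlpha hΔ]) hA
  obtain ⟨k, hk⟩ : ∃ k, k = min (((1 - 1 / 2) / c) ^ (rAlpha α - 1))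
    (((1 - 1 / 2) / c) ^ (pAlpha α - 1)) := ⟨_, rfl⟩
  have hk0 : 0 < k := by rw [hk]; exact lt_min (by positivity) (by positivity)
  set B := Metric.closedBall o R
  have hBm : MeasurableSet B := Metric.isClosed_closedBall.measurableSet
  have hBreal : 0 < μ.real B := ENNReal.toReal_pos hR.ne' (measure_ne_top μ B)
  have hcont : Continuous fun x => α (max (dist x o - R) 0) := hα.continuous.comp (by fun_prop)
  have hint : Integrable (fun x => α (max (dist x o - R) 0)) μ := by
    refine integrable_of_integral_min_le (c := -(k⁻¹ * Real.log (μ.real B))) hcont.measurable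
      (fun x => hα.nonneg _) fun n => ?_
    set f : X → ℝ := Bᶜ.indicator fun _ => -(n : ℝ)
    have hfB : ∀ x ∈ B, f x = 0 := fun x hx => indicator_of_notMem (by simpa using hx) _
    have hfB' : ∀ x ∉ B, f x = -n := fun x hx => indicator_of_mem (by simpa using hx) _
    have hf : ∀ x, |f x| ≤ n := fun x => by
      by_cases hx : x ∈ B
      · simp [hfB x hx]
      · simp [hfB' x hx]
    have hP1 : ∀ x, supConv α f 1 x ≤ -min (α (max (dist x o - R) 0)) n := fun x => by
      refine supConv_le fun y => ?_
      rw [one_mul, div_one]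
      by_cases hy : y ∈ B
      · rw [hfB y hy, zero_sub, neg_le_neg_iff]
        refine (min_le_left _ _).trans (hα.le_of_le (le_max_right _ _) (max_le ?_ dist_nonneg))
        have := dist_triangle x y o
        have := Metric.mem_closedBall.1 hy
        linarith
      · rw [hfB' y hy]
        have := hα.nonneg (dist x y)
        have := min_le_right (α (max (dist x o - R) 0)) (n : ℝ)
        linarith
    have hmeas : ∀ t, 0 < t → Measurable (supConv α f t) := fun t ht =>
      (supConv_lipschitz_space hα hΔ hf ht le_rfl).continuous.measurable
    have hmain := hLSI.logMGF_supConv_le_integral hA hα hΔ hf (by norm_num : (0 : ℝ) < 1 / 2)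
      (by norm_num) hc hk
    have hlog : Real.log (μ.real B) ≤
        Real.log (∫ x, Real.exp (k * supConv α f (1 / 2) x) ∂μ) := by
      refine Real.log_le_log hBreal ?_
      rw [← integral_indicator_one hBm]
      refine integral_mono ((integrable_const (1 : ℝ)).indicator hBm)
        (integrable_exp_of_abs_le (B := k * n) ((hmeas _ (by norm_num)).const_mul _) fun x => ?_)
        fun x => ?_
      · rw [abs_mul, abs_of_pos hk0]
        exact mul_le_mul_of_nonneg_left (abs_supConv_le hα hf (by norm_num) x) hk0.le
      · by_cases hx : x ∈ B
        · have := self_le_supConv hα hf (by norm_num : (0 : ℝ) < 1 / 2) x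
          rw [hfB x hx] at this
          simpa [hx] using mul_nonneg hk0.le this
        · simpa [hx] using (Real.exp_pos _).le
    have hup : ∫ x, supConv α f 1 x ∂μ ≤ ∫ x, -min (α (max (dist x o - R) 0)) n ∂μ := by
      refine integral_mono (.of_bound (hmeas 1 one_pos).aestronglyMeasurable n
        (Eventually.of_forall (abs_supConv_le hα hf one_pos))) ?_ hP1
      refine .of_bound (hcont.measurable.min measurable_const).neg.aestronglyMeasurable n
        (Eventually.of_forall fun x => ?_)
      rw [Real.norm_eq_abs, abs_neg, abs_of_nonneg (le_min (hα.nonneg _) (Nat.cast_nonneg n))]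
      exact min_le_right _ _
    rw [integral_neg] at hup
    have := mul_le_mul_of_nonneg_left hlog (inv_pos.2 hk0).le
    linarith
  obtain ⟨K, hK0, hK⟩ := hΔ
  refine ((hint.add (integrable_const (α R))).const_mul K).mono'
    (hα.continuous.comp (by fun_prop : Continuous fun x => dist x o)).aestronglyMeasurable
    (Eventually.of_forall fun x => ?_)
  rw [Real.norm_eq_abs, abs_of_nonneg (hα.nonneg _)]
  refine (hα.le_of_le dist_nonneg ?_).trans
    (hα.add_le hK0 hK (le_max_right (dist x o - R) 0) hR0)
  linarith [le_max_left (dist x o - R) 0]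

lemma LSIplus.integrable_comp_dist_of_llr (hLSI : LSIplus μ α A) (hA : 0 < A)
    (hα : IsYoung α) (hΔ : DeltaTwo α) [IsProbabilityMeasure ν] (hνμ : ν ≪ μ)
    (hH : Integrable (llr ν μ) ν) (o : X) : Integrable (fun x => α (dist x o)) ν := by
  have hμ := hLSI.integrable_comp_dist hA hα hΔ o
  have hΔ' := hΔ
  obtain ⟨K, hK0, hK⟩ := hΔ
  have hm : Measurable fun x => K⁻¹ * α (dist x o) :=
    ((hα.continuous.comp (by fun_prop : Continuous fun x => dist x o)).measurable).const_mul _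
  have hnn : ∀ x, 0 ≤ K⁻¹ * α (dist x o) := fun x => mul_nonneg (by positivity) (hα.nonneg _)
  have hint : Integrable (fun x => K⁻¹ * α (dist x o)) ν := by
    refine integrable_of_integral_min_le (c := ∫ x, α (dist x o) ∂μ
      + max (((pAlpha α - 1) * A) ^ (rAlpha α - 1)) (((pAlpha α - 1) * A) ^ (pAlpha α - 1))
        * ∫ x, llr ν μ x ∂ν) hm hnn fun n => ?_
    have hf : ∀ x, |min (K⁻¹ * α (dist x o)) n| ≤ n := fun x => by
      rw [abs_of_nonneg (le_min (hnn x) (Nat.cast_nonneg n))]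
      exact min_le_right _ _
    refine (hLSI.integral_le_integral_supConv_add hA hα hΔ' hf (hm.min measurable_const)
      hνμ hH).trans (add_le_add_left (integral_mono ?_ hμ fun x => ?_) _)
    · exact .of_bound (supConv_lipschitz_space hα hΔ' hf one_pos
        le_rfl).continuous.measurable.aestronglyMeasurable n
        (Eventually.of_forall (abs_supConv_le hα hf one_pos))
    · refine supConv_le fun y => ?_
      rw [one_mul, div_one, sub_le_iff_le_add]
      refine (min_le_left _ _).trans ((inv_mul_le_iff₀ hK0).2 ?_)
      refine (hα.le_of_le dist_nonneg ?_).trans (hα.add_le hK0 hK dist_nonneg dist_nonneg)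
      linarith [dist_triangle y x o, dist_comm x y]
  simpa [hK0.ne'] using hint.const_mul K

end Moments

/-- Kantorovich duality for finitely supported marginals. -/
lemma exists_coupling_of_dual_le {ι κ : Type*} [Fintype ι] [Fintype κ] {a : ι → ℝ} {b : κ → ℝ}
    {c : ι → κ → ℝ} {T : ℝ} (ha : ∀ i, 0 ≤ a i) (hb : ∀ j, 0 ≤ b j) (ha1 : ∑ i, a i = 1)
    (hb1 : ∑ j, b j = 1)
    (hdual : ∀ (φ : ι → ℝ) (ψ : κ → ℝ), (∀ i j, φ i + ψ j ≤ c i j) →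
      ∑ i, φ i * a i + ∑ j, ψ j * b j ≤ T) :
    ∃ p : ι → κ → ℝ, (∀ i j, 0 ≤ p i j) ∧ (∀ i, ∑ j, p i j = a i) ∧ (∀ j, ∑ i, p i j = b j) ∧
      ∑ i, ∑ j, p i j * c i j ≤ T := by
  classical
  let L : (ι × κ → ℝ) →ₗ[ℝ] (ι → ℝ) × (κ → ℝ) × ℝ :=
    { toFun := fun p => (fun i => ∑ j, p (i, j), fun j => ∑ i, p (i, j),
        ∑ i, ∑ j, p (i, j) * c i j)
      map_add' := fun p q => by
        ext <;> simp [Finset.sum_add_distrib, add_mul]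
      map_smul' := fun r p => by
        ext <;> simp [Finset.mul_sum, mul_assoc] }
  by_contra! hno
  have hLc : Continuous L := L.continuous_of_finiteDimensional
  obtain ⟨f, u, v, hS, huv, hD⟩ := geometric_hahn_banach_compact_closed
    (s := L '' stdSimplex ℝ (ι × κ)) (t := {a} ×ˢ ({b} ×ˢ Iic T))
    ((convex_stdSimplex ℝ _).linear_image L) ((isCompact_stdSimplex ℝ _).image hLc)
    ((convex_singleton a).prod ((convex_singleton b).prod (convex_Iic T)))
    (isClosed_singleton.prod (isClosed_singleton.prod isClosed_Iic)) (by
      rw [Set.disjoint_left]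
      rintro _ ⟨p, hp, rfl⟩ ⟨h1, h2, h3⟩
      refine (hno (fun i j => p (i, j)) (fun i j => hp.1 _) (fun i => congrFun h1 i)
        (fun j => congrFun h2 j)).not_ge h3)
  set φ : ι → ℝ := fun i => f (Pi.single i 1, 0, 0) with hφ
  set ψ : κ → ℝ := fun j => f (0, Pi.single j 1, 0) with hψ
  set lam : ℝ := f (0, 0, 1) with hlam
  have hf : ∀ x y s, f (x, y, s) = ∑ i, φ i * x i + ∑ j, ψ j * y j + lam * s := by
    intro x y s
    have h1 : (f.toLinearMap ∘ₗ LinearMap.inl ℝ (ι → ℝ) ((κ → ℝ) × ℝ)) x = ∑ i, φ i * x i := by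
      rw [LinearMap.pi_apply_eq_sum_univ]
      refine Finset.sum_congr rfl fun i _ => ?_
      have e : (fun j => if i = j then (1 : ℝ) else 0) = Pi.single i 1 := by
        ext j; simp [Pi.single_apply, eq_comm]
      rw [e, smul_eq_mul, mul_comm]
      rfl
    have h2 : (f.toLinearMap ∘ₗ LinearMap.inr ℝ (ι → ℝ) ((κ → ℝ) × ℝ)
        ∘ₗ LinearMap.inl ℝ (κ → ℝ) ℝ) y = ∑ j, ψ j * y j := by
      rw [LinearMap.pi_apply_eq_sum_univ]
      refine Finset.sum_congr rfl fun i _ => ?_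
      have e : (fun j => if i = j then (1 : ℝ) else 0) = Pi.single i 1 := by
        ext j; simp [Pi.single_apply, eq_comm]
      rw [e, smul_eq_mul, mul_comm]
      rfl
    have h3 : f (0, 0, s) = lam * s := by
      have : ((0, 0, s) : (ι → ℝ) × (κ → ℝ) × ℝ) = s • (0, 0, 1) := by simp
      rw [this, map_smul, smul_eq_mul, mul_comm]
    have h4 : ((x, y, s) : (ι → ℝ) × (κ → ℝ) × ℝ) = (x, 0, 0) + (0, y, 0) + (0, 0, s) := by simp
    rw [h4, map_add, map_add, ← h1, ← h2, h3]
    rfl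
  have hvert : ∀ i j, φ i + ψ j + lam * c i j < u := by
    intro i j
    have h := hS _ ⟨Pi.single (i, j) 1, single_mem_stdSimplex ℝ (i, j), rfl⟩
    have e : L (Pi.single (i, j) 1) = (Pi.single i 1, Pi.single j 1, c i j) := by
      ext
      · simp [L, Pi.single_apply, Prod.ext_iff, ite_and]
      · simp [L, Pi.single_apply, Prod.ext_iff, ite_and]
      · simp [L, Pi.single_apply, Prod.ext_iff, ite_and]
    rw [e, hf] at h
    simpa [Pi.single_apply] using h
  have hDs : ∀ s ≤ T, v < ∑ i, φ i * a i + ∑ j, ψ j * b j + lam * s := fun s hs => by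
    rw [← hf]
    exact hD _ ⟨rfl, rfl, hs⟩
  set W := ∑ i, φ i * a i + ∑ j, ψ j * b j with hW
  have hlam0 : lam ≤ 0 := by
    by_contra! hpos
    have h := hDs (min T ((v - W) / lam)) (min_le_left _ _)
    have h2 : lam * min T ((v - W) / lam) ≤ v - W := by
      calc _ ≤ lam * ((v - W) / lam) := mul_le_mul_of_nonneg_left (min_le_right _ _) hpos.le
        _ = v - W := by field_simp
    linarith
  have hT := hDs T le_rfl
  rcases hlam0.lt_or_eq with hneg | hzero
  · have h := hdual (fun i => (φ i - u) / (-lam)) (fun j => ψ j / (-lam)) fun i j => by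
      rw [← add_div, div_le_iff₀ (neg_pos.2 hneg)]
      linarith [hvert i j]
    have e : ∑ i, (φ i - u) / -lam * a i + ∑ j, ψ j / -lam * b j = (W - u) / (-lam) := by
      have e1 : ∑ i, (φ i - u) / -lam * a i = (∑ i, φ i * a i - u) / -lam := by
        calc _ = ∑ i, (φ i * a i - u * a i) / -lam :=
              Finset.sum_congr rfl fun i _ => by ring
          _ = _ := by rw [← Finset.sum_div, Finset.sum_sub_distrib, ← Finset.mul_sum, ha1, mul_one]
      have e2 : ∑ j, ψ j / -lam * b j = (∑ j, ψ j * b j) / -lam := by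
        rw [Finset.sum_div]
        exact Finset.sum_congr rfl fun i _ => by ring
      rw [e1, e2, ← add_div, hW]
      ring
    rw [e, div_le_iff₀ (neg_pos.2 hneg)] at h
    linarith
  · have h : W = ∑ i, ∑ j, (φ i + ψ j) * (a i * b j) := by
      have e1 : ∑ i, φ i * a i = ∑ i, ∑ j, φ i * a i * b j :=
        Finset.sum_congr rfl fun i _ => by rw [← Finset.mul_sum, hb1, mul_one]
      have e2 : ∑ j, ψ j * b j = ∑ i, ∑ j, ψ j * b j * a i := by
        rw [Finset.sum_comm]
        exact Finset.sum_congr rfl fun i _ => by rw [← Finset.mul_sum, ha1, mul_one]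
      rw [hW, e1, e2, ← Finset.sum_add_distrib]
      refine Finset.sum_congr rfl fun i _ => ?_
      rw [← Finset.sum_add_distrib]
      exact Finset.sum_congr rfl fun j _ => by ring
    have h2 : W ≤ ∑ i, ∑ j, u * (a i * b j) := by
      rw [h]
      refine Finset.sum_le_sum fun i _ => Finset.sum_le_sum fun j _ =>
        mul_le_mul_of_nonneg_right ?_ (mul_nonneg (ha i) (hb j))
      have := hvert i j
      rw [hzero] at this
      linarith
    have h3 : ∑ i, ∑ j, u * (a i * b j) = u := by
      simp_rw [← Finset.mul_sum, hb1, mul_one, ha1, mul_one]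
    rw [hzero] at hT
    linarith

lemma lintegral_comp_eq_sum {X ι : Type*} [MeasurableSpace X] {μ : Measure X} [Fintype ι]
    [MeasurableSpace ι] [MeasurableSingletonClass ι] {q : X → ι} (hq : Measurable q)
    (g : ι → ℝ≥0∞) : ∫⁻ x, g (q x) ∂μ = ∑ i, g i * μ (q ⁻¹' {i}) := by
  rw [← lintegral_map (measurable_of_finite g) hq, lintegral_fintype]
  exact Finset.sum_congr rfl fun i _ => by rw [Measure.map_apply hq (measurableSet_singleton i)]

lemma ae_measure_preimage_singleton_ne_zero {X ι : Type*} [MeasurableSpace X] {μ : Measure X}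
    [Countable ι] (q : X → ι) : ∀ᵐ x ∂μ, μ (q ⁻¹' {q x}) ≠ 0 := by
  rw [ae_iff]
  refine measure_mono_null (t := ⋃ i ∈ {i | μ (q ⁻¹' {i}) = 0}, q ⁻¹' {i}) (fun x hx => ?_)
    ((measure_biUnion_null_iff (to_countable _)).2 fun i hi => hi)
  simp only [ne_eq, not_not, mem_ofPred_eq] at hx
  exact mem_biUnion (show q x ∈ {i | μ (q ⁻¹' {i}) = 0} from hx) rfl

lemma sum_ofReal_div_mul_eq_one {κ : Type*} [Fintype κ] {a : ℝ≥0∞} {b : κ → ℝ≥0∞} {p : κ → ℝ}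
    (ha0 : a ≠ 0) (ha : a ≠ ∞) (hb : ∀ j, b j ≠ ∞) (hp : ∀ j, 0 ≤ p j) (hsum : ∑ j, p j = a.toReal)
    (hpb : ∀ j, b j = 0 → p j = 0) : ∑ j, ENNReal.ofReal (p j) / (a * b j) * b j = 1 := by
  have h : ∀ j, ENNReal.ofReal (p j) / (a * b j) * b j = ENNReal.ofReal (p j) / a := by
    intro j
    by_cases hj : b j = 0
    · simp [hpb j hj]
    · rw [mul_comm, ← mul_div_assoc, mul_comm a, ENNReal.mul_div_mul_left _ _ hj (hb j)]
  simp_rw [h, div_eq_mul_inv]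
  rw [← Finset.sum_mul, ← ENNReal.ofReal_sum_of_nonneg fun j _ => hp j, hsum,
    ENNReal.ofReal_toReal ha, ENNReal.mul_inv_cancel ha0 ha]

/-- A coupling of the images of `ν` and `μ` under a finite-valued map lifts to a coupling of
`ν` and `μ`. -/
lemma exists_measure_of_finite_coupling {X ι : Type*} [MeasurableSpace X] {ν μ : Measure X}
    [IsFiniteMeasure ν] [IsFiniteMeasure μ] [Fintype ι] [MeasurableSpace ι]
    [MeasurableSingletonClass ι] {q : X → ι} (hq : Measurable q) {p : ι → ι → ℝ}
    (hp : ∀ i j, 0 ≤ p i j) (hrow : ∀ i, ∑ j, p i j = ν.real (q ⁻¹' {i}))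
    (hcol : ∀ j, ∑ i, p i j = μ.real (q ⁻¹' {j})) :
    ∃ π : Measure (X × X), π.map Prod.fst = ν ∧ π.map Prod.snd = μ ∧
      ∀ F : ι → ι → ℝ≥0∞, ∫⁻ z, F (q z.1) (q z.2) ∂π
        = ∑ i, ∑ j, ENNReal.ofReal (p i j) * F i j := by
  set a : ι → ℝ≥0∞ := fun i => ν (q ⁻¹' {i})
  set b : ι → ℝ≥0∞ := fun j => μ (q ⁻¹' {j})
  have ha : ∀ i, a i ≠ ∞ := fun i => measure_ne_top _ _
  have hb : ∀ j, b j ≠ ∞ := fun j => measure_ne_top _ _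
  have hpa : ∀ i j, a i = 0 → p i j = 0 := fun i j h => by
    have h0 : ∑ j, p i j = 0 := by rw [hrow, measureReal_def]; simp only [a] at h; simp [h]
    exact (Finset.sum_eq_zero_iff_of_nonneg fun j _ => hp i j).1 h0 j (Finset.mem_univ j)
  have hpb : ∀ i j, b j = 0 → p i j = 0 := fun i j h => by
    have h0 : ∑ i, p i j = 0 := by rw [hcol, measureReal_def]; simp only [b] at h; simp [h]
    exact (Finset.sum_eq_zero_iff_of_nonneg fun i _ => hp i j).1 h0 i (Finset.mem_univ i)
  set w : ι → ι → ℝ≥0∞ := fun i j => ENNReal.ofReal (p i j) / (a i * b j)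
  have hqq : Measurable fun z : X × X => (q z.1, q z.2) :=
    (hq.comp measurable_fst).prodMk (hq.comp measurable_snd)
  have hmeas : ∀ F : ι → ι → ℝ≥0∞, Measurable fun z : X × X => F (q z.1) (q z.2) := fun F =>
    (measurable_of_finite (Function.uncurry F)).comp hqq
  refine ⟨(ν.prod μ).withDensity fun z => w (q z.1) (q z.2), ?_, ?_, fun F => ?_⟩
  · ext S hS
    rw [Measure.map_apply measurable_fst hS, withDensity_apply _ (measurable_fst hS),
      ← Set.prod_univ, ← Measure.prod_restrict, Measure.restrict_univ,
      lintegral_prod _ (hmeas w).aemeasurable]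
    have h1 : ∀ᵐ x ∂ν.restrict S, ∫⁻ y, w (q x) (q y) ∂μ = 1 := by
      filter_upwards [ae_restrict_of_ae (ae_measure_preimage_singleton_ne_zero (μ := ν) q)]
        with x hx
      rw [lintegral_comp_eq_sum hq]
      exact sum_ofReal_div_mul_eq_one hx (ha _) hb (hp _) (hrow _) (hpb _)
    rw [lintegral_congr_ae h1, setLIntegral_one]
  · ext S hS
    rw [Measure.map_apply measurable_snd hS, withDensity_apply _ (measurable_snd hS),
      ← Set.univ_prod, ← Measure.prod_restrict, Measure.restrict_univ,
      lintegral_prod_symm _ (hmeas w).aemeasurable]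
    have h1 : ∀ᵐ y ∂μ.restrict S, ∫⁻ x, w (q x) (q y) ∂ν = 1 := by
      filter_upwards [ae_restrict_of_ae (ae_measure_preimage_singleton_ne_zero (μ := μ) q)]
        with y hy
      rw [lintegral_comp_eq_sum hq (fun i => w i (q y))]
      simp only [w, mul_comm (a _)]
      exact sum_ofReal_div_mul_eq_one hy (hb _) ha (fun i => hp i _) (hcol _) fun i => hpa i _
    rw [lintegral_congr_ae h1, setLIntegral_one]
  · rw [lintegral_withDensity_eq_lintegral_mul _ (hmeas w) (hmeas F)]
    simp only [Pi.mul_apply]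
    rw [lintegral_prod _ (hmeas fun i j => w i j * F i j).aemeasurable]
    have h1 : ∀ x, ∫⁻ y, w (q x) (q y) * F (q x) (q y) ∂μ
        = ∑ j, w (q x) j * F (q x) j * b j := fun x =>
      lintegral_comp_eq_sum hq fun j => w (q x) j * F (q x) j
    simp_rw [h1]
    rw [lintegral_comp_eq_sum hq fun i => ∑ j, w i j * F i j * b j]
    refine Finset.sum_congr rfl fun i _ => ?_
    rw [Finset.sum_mul]
    refine Finset.sum_congr rfl fun j _ => ?_
    by_cases hi : a i = 0
    · simp [w, hpa i j hi]
    by_cases hj : b j = 0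
    · simp [w, hpb i j hj]
    have : w i j * F i j * b j * a i = w i j * (a i * b j) * F i j := by ring
    rw [show ν (q ⁻¹' {i}) = a i from rfl, this]
    simp only [w]
    rw [ENNReal.div_mul_cancel (mul_ne_zero hi hj) (ENNReal.mul_ne_top (ha i) (hb j))]

section Gluing

variable {X : Type*} [MetricSpace X] [MeasurableSpace X] [BorelSpace X]

lemma exists_finite_measurable_partition [ProperSpace X] (o : X) (R : ℝ) {δ : ℝ} (hδ : 0 < δ) :
    ∃ (n : ℕ) (q : X → Fin n), Measurable q ∧
      ∀ x x', dist x o ≤ R → q x = q x' → dist x x' < δ := by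
  obtain ⟨t, -, ht, hcov⟩ := (isCompact_closedBall o R).finite_cover_balls (half_pos hδ)
  have := ht.to_subtype
  obtain ⟨n, ⟨e⟩⟩ := Finite.exists_equiv_fin (t → Prop)
  have hm : Measurable fun (x : X) (c : t) => x ∈ Metric.ball (c : X) (δ / 2) :=
    measurable_pi_iff.2 fun c => measurableSet_setOfPred.1 Metric.isOpen_ball.measurableSet
  refine ⟨n, e ∘ fun x c => x ∈ Metric.ball (c : X) (δ / 2),
    (measurable_of_finite e).comp hm, fun x x' hx hxx' => ?_⟩
  obtain ⟨c, hct, hc⟩ := mem_iUnion₂.1 (hcov (Metric.mem_closedBall.2 hx))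
  have h := congrFun (e.injective hxx') ⟨c, hct⟩
  have hc' : x' ∈ Metric.ball c (δ / 2) := h.mp hc
  have := dist_triangle_right x x' c
  rw [Metric.mem_ball] at hc hc'
  linarith

lemma tendsto_setLIntegral_dist_gt (μ : Measure X) [IsFiniteMeasure μ] (o : X) {g : X → ℝ≥0∞}
    (hg : ∫⁻ x, g x ∂μ ≠ ∞) :
    Tendsto (fun n : ℕ => ∫⁻ x in {x | (n : ℝ) < dist x o}, g x ∂μ) atTop (𝓝 0) := by
  refine tendsto_setLIntegral_zero hg ?_
  have hmeas : ∀ n : ℕ, MeasurableSet {x | (n : ℝ) < dist x o} := fun n =>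
    (isOpen_lt continuous_const (by fun_prop)).measurableSet
  have h := tendsto_measure_iInter_atTop (μ := μ) (s := fun n : ℕ => {x | (n : ℝ) < dist x o})
    (fun n => (hmeas n).nullMeasurableSet)
    (fun m n hmn x hx => mem_ofPred.2 ((Nat.cast_le.2 hmn).trans_lt (mem_ofPred.1 hx)))
    ⟨0, measure_ne_top _ _⟩
  have he : ⋂ n : ℕ, {x : X | (n : ℝ) < dist x o} = ∅ := by
    refine eq_empty_of_forall_notMem fun x hx => ?_
    obtain ⟨n, hn⟩ := exists_nat_ge (dist x o)
    exact (mem_ofPred.1 (mem_iInter.1 hx n)).not_ge hn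
  rwa [he, measure_empty] at h

/-- Almost optimal couplings from the dual inequality. -/
lemma exists_coupling_lintegral_le [ProperSpace X] {μ ν : Measure X} [IsProbabilityMeasure μ]
    [IsProbabilityMeasure ν] {α : ℝ → ℝ} (hα : IsYoung α) (hΔ : DeltaTwo α) {o : X}
    (hμ : Integrable (fun x => α (dist x o)) μ) (hν : Integrable (fun x => α (dist x o)) ν) {T : ℝ}
    (hdual : ∀ (f : X → ℝ) (M : ℝ), Measurable f → (∀ x, |f x| ≤ M) →
      ∫ x, f x ∂ν ≤ ∫ x, supConv α f 1 x ∂μ + T) {ε : ℝ} (hε : 0 < ε) :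
    ∃ π : Measure (X × X), π.map Prod.fst = ν ∧ π.map Prod.snd = μ ∧
      ∫⁻ z, ENNReal.ofReal (α (dist z.1 z.2)) ∂π ≤ ENNReal.ofReal T + ENNReal.ofReal ε := by
  have hΔ' := hΔ
  obtain ⟨K, hK0, hK⟩ := hΔ
  set H : X → ℝ≥0∞ := fun x => ENNReal.ofReal (α (dist x o))
  have hcont : Continuous fun x => α (dist x o) := hα.continuous.comp (by fun_prop)
  have hHm : Measurable H := hcont.measurable.ennreal_ofReal
  obtain ⟨R, hR⟩ : ∃ n : ℕ, ENNReal.ofReal (2 * K) * (∫⁻ x in {x | (n : ℝ) < dist x o}, H x ∂ν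
      + ∫⁻ x in {x | (n : ℝ) < dist x o}, H x ∂μ) < ENNReal.ofReal (ε / 2) := by
    have h := ENNReal.Tendsto.const_mul (a := ENNReal.ofReal (2 * K))
      ((tendsto_setLIntegral_dist_gt ν o (g := H) hν.lintegral_lt_top.ne).add
        (tendsto_setLIntegral_dist_gt μ o (g := H) hμ.lintegral_lt_top.ne))
      (Or.inr ENNReal.ofReal_ne_top)
    rw [add_zero, mul_zero] at h
    exact (h.eventually_lt_const (ENNReal.ofReal_pos.2 (half_pos hε))).exists
  set s : Set X := {x | (R : ℝ) < dist x o}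
  have hs : MeasurableSet s := (isOpen_lt continuous_const (by fun_prop)).measurableSet
  obtain ⟨δ, hδ0, hδ⟩ : ∃ δ > 0, ∀ u ∈ Icc (0 : ℝ) (2 * R + 2), ∀ v ∈ Icc (0 : ℝ) (2 * R + 2),
      dist u v < δ → dist (α u) (α v) < ε / 2 :=
    Metric.uniformContinuousOn_iff.1
      (isCompact_Icc.uniformContinuousOn_of_continuous hα.continuous.continuousOn) _ (half_pos hε)
  obtain ⟨n, q, hq, hqδ⟩ := exists_finite_measurable_partition o R
    (lt_min (half_pos hδ0) one_pos : 0 < min (δ / 2) 1)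
  set c : Fin n → Fin n → ℝ := fun i j =>
    ⨅ z : {z : X × X // q z.1 = i ∧ q z.2 = j}, α (dist z.1.1 z.1.2)
  have hc0 : ∀ i j, 0 ≤ c i j := fun i j => Real.iInf_nonneg fun z => hα.nonneg _
  have hcle : ∀ x y, c (q x) (q y) ≤ α (dist x y) := fun x y =>
    ciInf_le (f := fun z : {z : X × X // q z.1 = q x ∧ q z.2 = q y} => α (dist z.1.1 z.1.2))
      ⟨0, by rintro _ ⟨z, rfl⟩; exact hα.nonneg _⟩ ⟨(x, y), rfl, rfl⟩
  have hlec : ∀ x y, dist x o ≤ R → dist y o ≤ R → α (dist x y) ≤ c (q x) (q y) + ε / 2 := by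
    intro x y hx hy
    rw [← sub_le_iff_le_add]
    have : Nonempty {z : X × X // q z.1 = q x ∧ q z.2 = q y} := ⟨⟨(x, y), rfl, rfl⟩⟩
    refine le_ciInf ?_
    rintro ⟨⟨x', y'⟩, hx', hy'⟩
    simp only at hx' hy' ⊢
    have h1 := lt_min_iff.1 (hqδ x x' hx hx'.symm)
    have h2 := lt_min_iff.1 (hqδ y y' hy hy'.symm)
    have h3 := dist_triangle_right x y o
    have h4 := dist_triangle4 x' x y y'
    have h5 := dist_triangle4 x x' y' y
    rw [dist_comm x' x] at h4
    rw [dist_comm y' y] at h5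
    have h := hδ (dist x y) ⟨dist_nonneg, by linarith⟩ (dist x' y') ⟨dist_nonneg, by linarith⟩
      (by rw [Real.dist_eq, abs_lt]; constructor <;> linarith)
    rw [Real.dist_eq, abs_lt] at h
    linarith
  have hsumq : ∀ (ρ : Measure X) [IsProbabilityMeasure ρ] (φ : Fin n → ℝ),
      ∫ x, φ (q x) ∂ρ = ∑ i, φ i * ρ.real (q ⁻¹' {i}) := by
    intro ρ _ φ
    have := Measure.isProbabilityMeasure_map (μ := ρ) hq.aemeasurable
    rw [← integral_map (f := φ) hq.aemeasurable (measurable_of_finite φ).aestronglyMeasurable,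
      integral_fintype .of_finite]
    refine Finset.sum_congr rfl fun i _ => ?_
    rw [map_measureReal_apply hq (measurableSet_singleton i), smul_eq_mul, mul_comm]
  have hone : ∀ (ρ : Measure X) [IsProbabilityMeasure ρ],
      ∑ i, ρ.real (q ⁻¹' {i}) = 1 := fun ρ _ => by
    simpa using (hsumq ρ fun _ => 1).symm
  obtain ⟨p, hp, hrow, hcol, hpc⟩ := exists_coupling_of_dual_le (c := c) (T := T)
    (fun i => measureReal_nonneg (μ := ν) (s := q ⁻¹' {i}))
    (fun i => measureReal_nonneg (μ := μ) (s := q ⁻¹' {i})) (hone ν) (hone μ) fun φ ψ hφψ => by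
      rw [← hsumq, ← hsumq]
      obtain ⟨M, hM⟩ : ∃ M, ∀ i, |φ i| ≤ M := by
        obtain ⟨M, hM⟩ := (finite_range fun i => |φ i|).bddAbove
        exact ⟨M, fun i => hM ⟨i, rfl⟩⟩
      have hfM : ∀ x, |φ (q x)| ≤ M := fun x => hM _
      have h := hdual (fun x => φ (q x)) M ((measurable_of_finite φ).comp hq) hfM
      have hP : ∫ x, supConv α (fun x => φ (q x)) 1 x ∂μ ≤ ∫ x, -ψ (q x) ∂μ := by
        refine integral_mono (.of_bound (supConv_lipschitz_space hα hΔ' hfM one_pos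
          le_rfl).continuous.measurable.aestronglyMeasurable M
          (Eventually.of_forall (abs_supConv_le hα hfM one_pos))) ?_ fun x =>
          supConv_le fun y => ?_
        · obtain ⟨N, hN⟩ := (finite_range fun i => |ψ i|).bddAbove
          refine .of_bound ((measurable_of_finite ψ).comp hq).neg.aestronglyMeasurable N
            (Eventually.of_forall fun x => ?_)
          rw [norm_neg]
          exact hN ⟨q x, rfl⟩
        · rw [one_mul, div_one]
          have h1 := hφψ (q y) (q x)
          have h2 := hcle y x
          rw [dist_comm] at h2
          linarith
      rw [integral_neg] at hP
      linarith
  obtain ⟨π, hπν, hπμ, hπ⟩ := exists_measure_of_finite_coupling hq hp hrow hcol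
  refine ⟨π, hπν, hπμ, ?_⟩
  have hπ1 : π univ = 1 := by
    rw [← preimage_univ (f := Prod.fst), ← Measure.map_apply measurable_fst .univ, hπν,
      measure_univ]
  have hpt : ∀ z : X × X, ENNReal.ofReal (α (dist z.1 z.2))
      ≤ ENNReal.ofReal (c (q z.1) (q z.2)) + ENNReal.ofReal (ε / 2)
        + ENNReal.ofReal (2 * K) * (s.indicator H z.1 + s.indicator H z.2) := by
    rintro ⟨x, y⟩
    simp only
    have hK2 : ∀ u, dist x o ≤ dist u o → dist y o ≤ dist u o →
        ENNReal.ofReal (α (dist x y)) ≤ ENNReal.ofReal (2 * K) * H u := by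
      intro u hx hy
      rw [← ENNReal.ofReal_mul (by positivity)]
      refine ENNReal.ofReal_le_ofReal ?_
      have h1 := (hα.le_of_le dist_nonneg (dist_triangle_right x y o)).trans
        (hα.add_le hK0 hK dist_nonneg dist_nonneg)
      have h2 := hα.le_of_le dist_nonneg hx
      have h3 := hα.le_of_le dist_nonneg hy
      nlinarith
    by_cases hxy : dist x o ≤ R ∧ dist y o ≤ R
    · refine le_add_right ?_
      rw [← ENNReal.ofReal_add (hc0 _ _) (half_pos hε).le]
      exact ENNReal.ofReal_le_ofReal (hlec x y hxy.1 hxy.2)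
    · refine le_add_left ?_
      rcases le_total (dist x o) (dist y o) with h | h
      · have hys : y ∈ s := by
          by_contra hys
          have := not_lt.1 fun h => hys (mem_ofPred.2 h)
          exact hxy ⟨h.trans this, this⟩
        refine (hK2 y h le_rfl).trans (mul_le_mul_right ?_ _)
        rw [indicator_of_mem hys]
        exact le_add_self
      · have hxs : x ∈ s := by
          by_contra hxs
          have := not_lt.1 fun h => hxs (mem_ofPred.2 h)
          exact hxy ⟨this, h.trans this⟩
        refine (hK2 x le_rfl h).trans (mul_le_mul_right ?_ _)
        rw [indicator_of_mem hxs]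
        exact le_self_add
  have hind : Measurable (s.indicator H) := hHm.indicator hs
  have hi1 : ∫⁻ z, s.indicator H z.1 ∂π = ∫⁻ x in s, H x ∂ν := by
    rw [← lintegral_indicator hs, ← hπν, lintegral_map hind measurable_fst]
  have hi2 : ∫⁻ z, s.indicator H z.2 ∂π = ∫⁻ x in s, H x ∂μ := by
    rw [← lintegral_indicator hs, ← hπμ, lintegral_map hind measurable_snd]
  have hic : ∫⁻ z, ENNReal.ofReal (c (q z.1) (q z.2)) ∂π ≤ ENNReal.ofReal T := by
    rw [hπ fun i j => ENNReal.ofReal (c i j)]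
    refine le_of_eq_of_le ?_ (ENNReal.ofReal_le_ofReal hpc)
    rw [ENNReal.ofReal_sum_of_nonneg fun i _ =>
      Finset.sum_nonneg fun j _ => mul_nonneg (hp i j) (hc0 i j)]
    refine Finset.sum_congr rfl fun i _ => ?_
    rw [ENNReal.ofReal_sum_of_nonneg fun j _ => mul_nonneg (hp i j) (hc0 i j)]
    exact Finset.sum_congr rfl fun j _ => (ENNReal.ofReal_mul (hp i j)).symm
  have hind1 : Measurable fun z : X × X => s.indicator H z.1 := hind.comp measurable_fst
  have hind2 : Measurable fun z : X × X => s.indicator H z.2 := hind.comp measurable_snd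
  have hind12 : Measurable fun z : X × X => s.indicator H z.1 + s.indicator H z.2 :=
    hind1.add hind2
  refine (lintegral_mono hpt).trans ?_
  rw [lintegral_add_right _ (hind12.const_mul _), lintegral_add_right _ measurable_const,
    lintegral_const_mul _ hind12, lintegral_add_left hind1, hi1, hi2, lintegral_const,
    hπ1, mul_one, add_assoc]
  refine add_le_add hic ((add_le_add_right hR.le _).trans_eq ?_)
  rw [← ENNReal.ofReal_add (half_pos hε).le (half_pos hε).le, add_halves]

end Gluing

theorem lsi_plus_implies_transport_entropy
    {X : Type*} [MetricSpace X] [CompleteSpace X] [TopologicalSpace.SeparableSpace X]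
    [ProperSpace X] [MeasurableSpace X] [BorelSpace X]
    (α : ℝ → ℝ) (hα : IsYoung α) (hΔ : DeltaTwo α)
    (μ : Measure X) [IsProbabilityMeasure μ] (A : ℝ) (hA : 0 < A)
    (hLSI : LSIplus μ α A) :
    TransportEntropy μ α
      (max (((pAlpha α - 1) * A) ^ (rAlpha α - 1))
        (((pAlpha α - 1) * A) ^ (pAlpha α - 1))) := by
  intro ν _
  obtain ⟨o⟩ : Nonempty X := μ.nonempty_of_neZero
  have hC : 0 < max (((pAlpha α - 1) * A) ^ (rAlpha α - 1))
      (((pAlpha α - 1) * A) ^ (pAlpha α - 1)) :=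
    lt_max_of_lt_left (Real.rpow_pos_of_pos
      (mul_pos (by linarith [hα.one_lt_pAlpha hΔ]) hA) _)
  by_cases h : ν ≪ μ ∧ Integrable (fun x => Real.log (ν.rnDeriv μ x).toReal) ν
  · obtain ⟨hνμ, hH⟩ := h
    rw [relEnt, if_pos ⟨hνμ, hH⟩, ← ENNReal.ofReal_mul hC.le]
    refine ENNReal.le_of_forall_pos_le_add fun ε hε _ => ?_
    obtain ⟨π, hπν, hπμ, hπ⟩ := exists_coupling_lintegral_le hα hΔ
      (hLSI.integrable_comp_dist hA hα hΔ o)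
      (hLSI.integrable_comp_dist_of_llr hA hα hΔ hνμ hH o)
      (fun f M hfm hfM => hLSI.integral_le_integral_supConv_add hA hα hΔ hfM hfm hνμ hH)
      (NNReal.coe_pos.2 hε)
    rw [ENNReal.ofReal_coe_nnreal] at hπ
    refine le_trans ?_ hπ
    exact sInf_le (mem_ofPred.2 ⟨π, hπν, hπμ, rfl⟩)
  · rw [relEnt, if_neg h, ENNReal.mul_top (ENNReal.ofReal_pos.2 hC).ne']
    exact le_top
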